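/- arXiv:1605.09038 — 7 statements merged into one kernel-verified Lean document; each statement's English description precedes it below -/
import Mathlib

section
/- Let 𝒳₁, 𝒳₂, 𝒴 be finite nonempty sets, let W(y|x₁,x₂) be a discrete memoryless multiple access channel, and let p₁, p₂ be probability mass functions on 𝒳₁, 𝒳₂. With P(x₁,x₂,y) = p₁(x₁)p₂(x₂)W(y|x₁,x₂), define I(X₁;Y|X₂) = Σ P(x₁,x₂,y) log₂( P(x₁,x₂,y) / (p₁(x₁)·Σ_{x₁'}P(x₁',x₂,y)) ), I(X₂;Y|X₁) = Σ P(x₁,x₂,y) log₂( P(x₁,x₂,y) / (p₂(x₂)·Σ_{x₂'}P(x₁,x₂',y)) ), and I(X₁,X₂;Y) = Σ P(x₁,x₂,y) log₂( P(x₁,x₂,y) / (p₁(x₁)p₂(x₂)·Σ_{x₁',x₂'}P(x₁',x₂',y)) ), with zero-probability terms contributing 0. Then for all reals R₁, R₂ > 0 with R₁ < I(X₁;Y|X₂), R₂ < I(X₂;Y|X₁), R₁ + R₂ < I(X₁,X₂;Y), and every ε > 0, there exists K such that for every k ≥ K there exist integers n₁ ≥ 2^{R₁k}, n₂ ≥ 2^{R₂k},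 sequences x₁ ∈ 𝒳₁^{n₁}, x₂ ∈ 𝒳₂^{n₂}, and a detector g : 𝒴^k → {1,…,n₁}×{1,…,n₂} whose average probability of error satisfies (1/(n₁n₂))·Σ_{m₁=1}^{n₁}Σ_{m₂=1}^{n₂} Σ_{y^k : g(y^k) ≠ (m₁,m₂)} ∏_{i=0}^{k−1} W(y_{1+i} | x_{1,m₁+i}, x_{2,m₂+i}) ≤ ε, where the indices of x₁ and x₂ are taken cyclically modulo n₁ and n₂ respectively. -/
/-- Length-`k` cyclic window of the sequence `x` (indexed cyclically by `ZMod n`)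
starting at phase `m`: `(x_m, x_{m+1}, …, x_{m+k-1})` with indices modulo `n`. -/
def win {α : Type*} {n : ℕ} (k : ℕ) (x : ZMod n → α) (m : ZMod n) : Fin k → α :=
  fun i => x (m + ((i : ℕ) : ZMod n))

/-- Probability of the sequence `x` when its letters are independent with law `p`. -/
def seqWeight {ι A : Type*} [Fintype ι] (p : A → ℝ) (x : ι → A) : ℝ := ∏ i, p (x i)

lemma seqWeight_nonneg {ι A : Type*} [Fintype ι] {p : A → ℝ} (hp : ∀ a, 0 ≤ p a) (x : ι → A) :
    0 ≤ seqWeight p x :=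
  Finset.prod_nonneg fun _ _ => hp _

lemma sum_seqWeight {ι A : Type*} [Fintype ι] [DecidableEq ι] [Fintype A] {p : A → ℝ}
    (hp : ∑ a, p a = 1) : ∑ x : ι → A, seqWeight p x = 1 := by
  have h := (Finset.prod_univ_sum (fun _ : ι => (Finset.univ : Finset A)) fun _ a => p a).symm
  rw [Fintype.piFinset_univ] at h
  simpa [seqWeight, hp] using h

/-- Redrawing one letter of an i.i.d. sequence does not change expectations. -/
lemma sum_seqWeight_resample {ι A : Type*} [Fintype ι] [DecidableEq ι] [Fintype A] {p : A → ℝ}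
    (hp : ∑ a, p a = 1) (c : ι) (F : (ι → A) → ℝ) :
    ∑ x, seqWeight p x * F x =
      ∑ x, seqWeight p x * ∑ a, p a * F (Function.update x c a) := by
  have hw : ∀ (x : ι → A) (a : A),
      seqWeight p (Function.update x c a) * p (x c) = seqWeight p x * p a := by
    intro x a
    simp only [seqWeight]
    rw [← Finset.mul_prod_erase _ _ (Finset.mem_univ c),
      ← Finset.mul_prod_erase _ (fun i => p (x i)) (Finset.mem_univ c)]
    have : ∏ i ∈ Finset.univ.erase c, p (Function.update x c a i) =
        ∏ i ∈ Finset.univ.erase c, p (x i) :=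
      Finset.prod_congr rfl fun i hi => by
        rw [Function.update_of_ne (Finset.ne_of_mem_erase hi)]
    rw [this, Function.update_self]
    ring
  have hl : ∑ x, seqWeight p x * F x = ∑ z : (ι → A) × A, seqWeight p z.1 * p z.2 * F z.1 := by
    rw [Fintype.sum_prod_type]
    refine Finset.sum_congr rfl fun x _ => ?_
    calc seqWeight p x * F x = seqWeight p x * F x * ∑ a, p a := by rw [hp, mul_one]
      _ = _ := by
        rw [Finset.mul_sum]
        exact Finset.sum_congr rfl fun a _ => by ring
  rw [hl]
  simp_rw [Finset.mul_sum]
  rw [← Fintype.sum_prod_type' (f := fun (x : ι → A) (a : A) =>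
    seqWeight p x * (p a * F (Function.update x c a)))]
  refine Finset.sum_nbij' (fun z => (Function.update z.1 c z.2, z.1 c))
    (fun z => (Function.update z.1 c z.2, z.1 c)) (by simp) (by simp) ?_ ?_ ?_
  · rintro ⟨x, a⟩ -
    simp
  · rintro ⟨x, a⟩ -
    simp
  · rintro ⟨x, a⟩ -
    simp only [Function.update_idem, Function.update_eq_self]
    rw [← mul_assoc, hw]

/-- Expectation over two independent i.i.d. sequences with laws `p1` and `p2`. -/
def codeAvg {ι1 ι2 X1 X2 : Type*} [Fintype ι1] [Fintype ι2] [DecidableEq ι1] [DecidableEq ι2]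
    [Fintype X1] [Fintype X2] (p1 : X1 → ℝ) (p2 : X2 → ℝ)
    (F : (ι1 → X1) → (ι2 → X2) → ℝ) : ℝ :=
  ∑ x1, ∑ x2, seqWeight p1 x1 * (seqWeight p2 x2 * F x1 x2)

section CodeAvg

variable {ι1 ι2 κ X1 X2 Y : Type*} [Fintype ι1] [Fintype ι2] [DecidableEq ι1] [DecidableEq ι2]
  [Fintype X1] [Fintype X2] {p1 : X1 → ℝ} {p2 : X2 → ℝ}

lemma codeAvg_mono (hp10 : ∀ a, 0 ≤ p1 a) (hp20 : ∀ b, 0 ≤ p2 b)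
    {F G : (ι1 → X1) → (ι2 → X2) → ℝ} (h : ∀ x1 x2, F x1 x2 ≤ G x1 x2) :
    codeAvg p1 p2 F ≤ codeAvg p1 p2 G :=
  Finset.sum_le_sum fun _ _ => Finset.sum_le_sum fun _ _ =>
    mul_le_mul_of_nonneg_left (mul_le_mul_of_nonneg_left (h _ _) (seqWeight_nonneg hp20 _))
      (seqWeight_nonneg hp10 _)

lemma codeAvg_const (hp11 : ∑ a, p1 a = 1) (hp21 : ∑ b, p2 b = 1) (c : ℝ) :
    codeAvg p1 p2 (fun (_ : ι1 → X1) (_ : ι2 → X2) => c) = c := by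
  simp only [codeAvg, ← Finset.mul_sum, ← Finset.sum_mul, sum_seqWeight hp11, sum_seqWeight hp21,
    one_mul]

lemma codeAvg_mul_const (c : ℝ) (F : (ι1 → X1) → (ι2 → X2) → ℝ) :
    codeAvg p1 p2 (fun x1 x2 => F x1 x2 * c) = codeAvg p1 p2 F * c := by
  simp only [codeAvg, Finset.sum_mul, mul_assoc]

lemma codeAvg_sum {τ : Type*} (s : Finset τ) (F : τ → (ι1 → X1) → (ι2 → X2) → ℝ) :
    codeAvg p1 p2 (fun x1 x2 => ∑ t ∈ s, F t x1 x2) = ∑ t ∈ s, codeAvg p1 p2 (F t) := by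
  simp only [codeAvg, Finset.mul_sum]
  rw [Finset.sum_comm]
  conv_rhs => rw [Finset.sum_comm]
  rw [Finset.sum_comm]
  refine Finset.sum_congr rfl fun _ _ => Finset.sum_comm

lemma codeAvg_resample (hp11 : ∑ a, p1 a = 1) (hp21 : ∑ b, p2 b = 1) (c1 : ι1) (c2 : ι2)
    (F : (ι1 → X1) → (ι2 → X2) → ℝ) :
    codeAvg p1 p2 F = codeAvg p1 p2 fun x1 x2 =>
      ∑ a, ∑ b, p1 a * p2 b * F (Function.update x1 c1 a) (Function.update x2 c2 b) := by
  simp only [codeAvg, ← Finset.mul_sum]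
  rw [sum_seqWeight_resample hp11 c1]
  refine Finset.sum_congr rfl fun x1 _ => ?_
  congr 1
  calc ∑ a, p1 a * ∑ x2, seqWeight p2 x2 * F (Function.update x1 c1 a) x2
      = ∑ a, p1 a * ∑ x2, seqWeight p2 x2 *
          ∑ b, p2 b * F (Function.update x1 c1 a) (Function.update x2 c2 b) :=
        Finset.sum_congr rfl fun a _ => by rw [sum_seqWeight_resample hp21 c2]
    _ = _ := by
        simp only [Finset.mul_sum]
        rw [Finset.sum_comm]
        refine Finset.sum_congr rfl fun x2 _ => Finset.sum_congr rfl fun a _ =>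
          Finset.sum_congr rfl fun b _ => by ring

/-- A product of nonnegative factors has expectation at most `c ^ #S` if the factors can be
eliminated one at a time: in the order given by `key`, the letters at positions `u1 i`, `u2 i`
only influence factor `i` among those that remain, and redrawing them gives factor `i` a
conditional expectation of at most `c`. -/
lemma codeAvg_prod_le (hp10 : ∀ a, 0 ≤ p1 a) (hp11 : ∑ a, p1 a = 1)
    (hp20 : ∀ b, 0 ≤ p2 b) (hp21 : ∑ b, p2 b = 1)
    (u1 : κ → ι1) (u2 : κ → ι2) (f : κ → (ι1 → X1) → (ι2 → X2) → ℝ)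
    (hf : ∀ i x1 x2, 0 ≤ f i x1 x2) (key : κ → ℤ) (c : ℝ) (hc : 0 ≤ c) (S : Finset κ)
    (hsum : ∀ i ∈ S, ∀ x1 x2, ∑ a, ∑ b, p1 a * p2 b *
      f i (Function.update x1 (u1 i) a) (Function.update x2 (u2 i) b) ≤ c)
    (hfresh : ∀ i ∈ S, ∀ j ∈ S, j ≠ i → key j ≤ key i → ∀ x1 x2 a b,
      f j (Function.update x1 (u1 i) a) (Function.update x2 (u2 i) b) = f j x1 x2) :
    codeAvg p1 p2 (fun x1 x2 => ∏ i ∈ S, f i x1 x2) ≤ c ^ S.card := by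
  classical
  induction S using Finset.induction_on_max_value key with
  | empty => simp [codeAvg_const hp11 hp21]
  | insert i s hi hmax ih =>
    have ih' := ih (fun j hj => hsum j (Finset.mem_insert_of_mem hj))
      (fun j hj l hl => hfresh j (Finset.mem_insert_of_mem hj) l (Finset.mem_insert_of_mem hl))
    rw [Finset.card_insert_of_notMem hi, pow_succ]
    refine le_trans ?_ (mul_le_mul_of_nonneg_right ih' hc)
    rw [codeAvg_resample hp11 hp21 (u1 i) (u2 i), ← codeAvg_mul_const]
    refine codeAvg_mono hp10 hp20 fun x1 x2 => ?_
    have hG : ∀ a b, ∏ j ∈ s, f j (Function.update x1 (u1 i) a) (Function.update x2 (u2 i) b) =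
        ∏ j ∈ s, f j x1 x2 := fun a b => Finset.prod_congr rfl fun j hj =>
      hfresh i (Finset.mem_insert_self _ _) j (Finset.mem_insert_of_mem hj)
        (fun h => hi (h ▸ hj)) (hmax j hj) x1 x2 a b
    simp only [Finset.prod_insert hi, hG]
    calc _ = (∏ j ∈ s, f j x1 x2) * ∑ a, ∑ b, p1 a * p2 b *
          f i (Function.update x1 (u1 i) a) (Function.update x2 (u2 i) b) := by
          simp only [Finset.mul_sum]
          exact Finset.sum_congr rfl fun a _ => Finset.sum_congr rfl fun b _ => by ring
      _ ≤ _ := mul_le_mul_of_nonneg_left (hsum i (Finset.mem_insert_self _ _) x1 x2)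
          (Finset.prod_nonneg fun j _ => hf _ _ _)

end CodeAvg

/-- Expectation of `F` when the two sequences are i.i.d. and `y` is the channel output for the
letters at positions `u1 i`, `u2 i`. -/
def jointAvg {ι1 ι2 κ X1 X2 Y : Type*} [Fintype ι1] [Fintype ι2] [Fintype κ] [DecidableEq ι1]
    [DecidableEq ι2] [DecidableEq κ] [Fintype X1] [Fintype X2] [Fintype Y]
    (W : X1 → X2 → Y → ℝ) (p1 : X1 → ℝ) (p2 : X2 → ℝ) (u1 : κ → ι1) (u2 : κ → ι2)
    (F : (ι1 → X1) → (ι2 → X2) → (κ → Y) → ℝ) : ℝ :=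
  codeAvg p1 p2 fun x1 x2 => ∑ y : κ → Y, (∏ i, W (x1 (u1 i)) (x2 (u2 i)) (y i)) * F x1 x2 y

section JointAvg

variable {ι1 ι2 κ X1 X2 Y : Type*} [Fintype ι1] [Fintype ι2] [Fintype κ] [DecidableEq ι1]
  [DecidableEq ι2] [DecidableEq κ] [Fintype X1] [Fintype X2] [Fintype Y]
  {W : X1 → X2 → Y → ℝ} {p1 : X1 → ℝ} {p2 : X2 → ℝ} {u1 : κ → ι1} {u2 : κ → ι2}

lemma jointAvg_mono (hW0 : ∀ a b y, 0 ≤ W a b y) (hp10 : ∀ a, 0 ≤ p1 a) (hp20 : ∀ b, 0 ≤ p2 b)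
    {F G : (ι1 → X1) → (ι2 → X2) → (κ → Y) → ℝ}
    (h : ∀ x1 x2 y, (∀ i, 0 < p1 (x1 (u1 i)) * p2 (x2 (u2 i)) * W (x1 (u1 i)) (x2 (u2 i)) (y i)) →
      F x1 x2 y ≤ G x1 x2 y) :
    jointAvg W p1 p2 u1 u2 F ≤ jointAvg W p1 p2 u1 u2 G := by
  refine Finset.sum_le_sum fun x1 _ => Finset.sum_le_sum fun x2 _ => ?_
  simp only [Finset.mul_sum]
  refine Finset.sum_le_sum fun y _ => ?_
  by_cases hpos : ∀ i, 0 < p1 (x1 (u1 i)) * p2 (x2 (u2 i)) * W (x1 (u1 i)) (x2 (u2 i)) (y i)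
  · exact mul_le_mul_of_nonneg_left (mul_le_mul_of_nonneg_left (mul_le_mul_of_nonneg_left
      (h x1 x2 y hpos) (Finset.prod_nonneg fun _ _ => hW0 _ _ _)) (seqWeight_nonneg hp20 _))
      (seqWeight_nonneg hp10 _)
  · push Not at hpos
    obtain ⟨i, hi⟩ := hpos
    have h0 := le_antisymm hi (mul_nonneg (mul_nonneg (hp10 _) (hp20 _)) (hW0 _ _ _))
    rcases mul_eq_zero.mp h0 with h0 | h0
    · rcases mul_eq_zero.mp h0 with h0 | h0
      · have : seqWeight p1 x1 = 0 := Finset.prod_eq_zero (Finset.mem_univ (u1 i)) h0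
        simp [this]
      · have : seqWeight p2 x2 = 0 := Finset.prod_eq_zero (Finset.mem_univ (u2 i)) h0
        simp [this]
    · have : ∏ i, W (x1 (u1 i)) (x2 (u2 i)) (y i) = 0 :=
        Finset.prod_eq_zero (Finset.mem_univ i) h0
      simp [this]

lemma jointAvg_sum {τ : Type*} (s : Finset τ) (F : τ → (ι1 → X1) → (ι2 → X2) → (κ → Y) → ℝ) :
    jointAvg W p1 p2 u1 u2 (fun x1 x2 y => ∑ t ∈ s, F t x1 x2 y) =
      ∑ t ∈ s, jointAvg W p1 p2 u1 u2 (F t) := by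
  simp only [jointAvg]
  rw [← codeAvg_sum]
  congr 1
  funext x1 x2
  simp only [Finset.mul_sum]
  exact Finset.sum_comm

lemma jointAvg_add (F G : (ι1 → X1) → (ι2 → X2) → (κ → Y) → ℝ) :
    jointAvg W p1 p2 u1 u2 (fun x1 x2 y => F x1 x2 y + G x1 x2 y) =
      jointAvg W p1 p2 u1 u2 F + jointAvg W p1 p2 u1 u2 G := by
  simpa using jointAvg_sum (W := W) (p1 := p1) (p2 := p2) (u1 := u1) (u2 := u2) Finset.univ
    (fun t : Bool => if t then F else G)

lemma jointAvg_mul_const (F : (ι1 → X1) → (ι2 → X2) → (κ → Y) → ℝ) (c : ℝ) :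
    jointAvg W p1 p2 u1 u2 (fun x1 x2 y => F x1 x2 y * c) = jointAvg W p1 p2 u1 u2 F * c := by
  simp only [jointAvg]
  rw [← codeAvg_mul_const]
  congr 1
  funext x1 x2
  simp only [Finset.sum_mul, mul_assoc]

/-- Expectation of a product of scores at positions `v1 i`, `v2 i`, computed by eliminating the
positions one at a time in the order given by `key`. -/
lemma jointAvg_prod_le (hW0 : ∀ a b y, 0 ≤ W a b y) (hW1 : ∀ a b, ∑ y, W a b y = 1)
    (hp10 : ∀ a, 0 ≤ p1 a) (hp11 : ∑ a, p1 a = 1)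
    (hp20 : ∀ b, 0 ≤ p2 b) (hp21 : ∑ b, p2 b = 1)
    (hu1 : Function.Injective u1) (hu2 : Function.Injective u2) (v1 : κ → ι1) (v2 : κ → ι2)
    {s : X1 → X2 → Y → ℝ} (hs : ∀ a b y, 0 ≤ s a b y) (key : κ → ℤ) {c : ℝ} (hc : 0 ≤ c)
    (S : Finset κ)
    (hsum : ∀ i ∈ S, ∀ (x1 : ι1 → X1) (x2 : ι2 → X2), ∑ a, ∑ b, p1 a * p2 b * ∑ y, W a b y *
      s (Function.update x1 (u1 i) a (v1 i)) (Function.update x2 (u2 i) b (v2 i)) y ≤ c)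
    (hfresh1 : ∀ i ∈ S, ∀ j ∈ S, j ≠ i → key j ≤ key i → v1 j ≠ u1 i)
    (hfresh2 : ∀ i ∈ S, ∀ j ∈ S, j ≠ i → key j ≤ key i → v2 j ≠ u2 i) :
    jointAvg W p1 p2 u1 u2 (fun x1 x2 y => ∏ i ∈ S, s (x1 (v1 i)) (x2 (v2 i)) (y i)) ≤
      c ^ S.card := by
  have key_eq : jointAvg W p1 p2 u1 u2
      (fun x1 x2 y => ∏ i ∈ S, s (x1 (v1 i)) (x2 (v2 i)) (y i)) =
      codeAvg p1 p2 fun x1 x2 => ∏ i ∈ S,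
        ∑ y, W (x1 (u1 i)) (x2 (u2 i)) y * s (x1 (v1 i)) (x2 (v2 i)) y := by
    simp only [jointAvg]
    congr 1
    funext x1 x2
    have h := Finset.prod_univ_sum (fun _ : κ => (Finset.univ : Finset Y)) fun i y =>
      W (x1 (u1 i)) (x2 (u2 i)) y * if i ∈ S then s (x1 (v1 i)) (x2 (v2 i)) y else 1
    rw [Fintype.piFinset_univ] at h
    simp only [Finset.prod_mul_distrib, Finset.prod_ite_mem, Finset.univ_inter] at h
    rw [← h, ← Finset.prod_subset (Finset.subset_univ S)]
    · exact Finset.prod_congr rfl fun i hi => by simp [hi]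
    · intro i _ hi
      simp [hi, hW1]
  rw [key_eq]
  refine codeAvg_prod_le hp10 hp11 hp20 hp21 u1 u2
    (fun i x1 x2 => ∑ y, W (x1 (u1 i)) (x2 (u2 i)) y * s (x1 (v1 i)) (x2 (v2 i)) y)
    (fun i x1 x2 => Finset.sum_nonneg fun y _ => mul_nonneg (hW0 _ _ _) (hs _ _ _)) key c hc S
    ?_ ?_
  · intro i hi x1 x2
    simpa only [Function.update_self] using hsum i hi x1 x2
  · intro i hi j hj hij hk x1 x2 a b
    rw [Function.update_of_ne (hu1.ne hij), Function.update_of_ne (hu2.ne hij),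
      Function.update_of_ne (hfresh1 i hi j hj hij hk),
      Function.update_of_ne (hfresh2 i hi j hj hij hk)]

end JointAvg

/-- The number `1` if `P` holds and `0` otherwise. -/
noncomputable def boolReal (P : Prop) : ℝ := by
  classical exact if P then 1 else 0

lemma boolReal_pos {P : Prop} (h : P) : boolReal P = 1 := by simp [boolReal, h]

lemma boolReal_neg {P : Prop} (h : ¬P) : boolReal P = 0 := by simp [boolReal, h]

lemma boolReal_nonneg (P : Prop) : 0 ≤ boolReal P := by
  by_cases h : P
  · simp [boolReal_pos h]
  · simp [boolReal_neg h]

/-- The positions read by the length-`k` window at phase `m`. -/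
def winPos {n : ℕ} (k : ℕ) (m : ZMod n) (i : Fin k) : ZMod n := m + ((i : ℕ) : ZMod n)

section WinPos

variable {n k : ℕ}

lemma natCast_zmod_inj {a b : ℕ} (ha : a < n) (hb : b < n) (h : (a : ZMod n) = b) : a = b := by
  rw [ZMod.natCast_eq_natCast_iff'] at h
  rwa [Nat.mod_eq_of_lt ha, Nat.mod_eq_of_lt hb] at h

lemma winPos_injective (hk : k ≤ n) (m : ZMod n) : Function.Injective (winPos k m) := by
  intro i j h
  exact Fin.ext (natCast_zmod_inj (i.2.trans_le hk) (j.2.trans_le hk) (add_left_cancel h))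

lemma winPos_ne {m m' : ZMod n} (h : m' ≠ m) (i : Fin k) : winPos k m' i ≠ winPos k m i :=
  fun h' => h (add_right_cancel h')

/-- No letter of the window at `m'` occurs at the same or an earlier place in the window at `m`. -/
def FwdFresh (k : ℕ) (m m' : ZMod n) : Prop :=
  ∀ i j : Fin k, i ≤ j → winPos k m' j ≠ winPos k m i

/-- No letter of the window at `m'` occurs at the same or a later place in the window at `m`. -/
def BwdFresh (k : ℕ) (m m' : ZMod n) : Prop :=
  ∀ i j : Fin k, j ≤ i → winPos k m' j ≠ winPos k m i

lemma exists_of_not_fwdFresh {m m' : ZMod n} (h : ¬FwdFresh k m m') :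
    ∃ v : Fin k, m' + ((v : ℕ) : ZMod n) = m := by
  simp only [FwdFresh, not_forall, not_not, winPos] at h
  obtain ⟨i, j, hij, h⟩ := h
  refine ⟨⟨j - i, (Nat.sub_le _ _).trans_lt j.2⟩, ?_⟩
  rw [Nat.cast_sub hij]
  linear_combination h

lemma exists_of_not_bwdFresh {m m' : ZMod n} (h : ¬BwdFresh k m m') :
    ∃ v : Fin k, m + ((v : ℕ) : ZMod n) = m' := by
  simp only [BwdFresh, not_forall, not_not, winPos] at h
  obtain ⟨i, j, hij, h⟩ := h
  refine ⟨⟨i - j, (Nat.sub_le _ _).trans_lt i.2⟩, ?_⟩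
  rw [Nat.cast_sub hij]
  linear_combination -h

lemma fwdFresh_or_bwdFresh (hk : 2 * k ≤ n) {m m' : ZMod n} (h : m' ≠ m) :
    FwdFresh k m m' ∨ BwdFresh k m m' := by
  by_contra! hc
  obtain ⟨u, hu⟩ := exists_of_not_fwdFresh hc.1
  obtain ⟨v, hv⟩ := exists_of_not_bwdFresh hc.2
  have h0 : (((u : ℕ) + (v : ℕ) : ℕ) : ZMod n) = ((0 : ℕ) : ZMod n) := by
    push_cast
    linear_combination hu + hv
  have hn : (u : ℕ) + (v : ℕ) < n := by omega
  have h1 := natCast_zmod_inj hn (by omega) h0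
  have h2 : (v : ℕ) = 0 := by omega
  rw [h2] at hv
  exact h (by simpa using hv.symm)

/-- The places of a window split into two classes, on each of which the window at `m'` is fresh
relative to the window at `m`. -/
lemma exists_fresh_coloring (hk : 2 * k ≤ n) {m m' : ZMod n} (h : m' ≠ m) :
    ∃ c : Fin k → Bool, ∀ i j, c i = c j → i ≤ j → winPos k m' j ≠ winPos k m i := by
  by_cases hf : FwdFresh k m m'
  · exact ⟨fun _ => true, fun i j _ => hf i j⟩
  obtain ⟨v, hv⟩ := exists_of_not_fwdFresh hf
  have hv0 : 0 < (v : ℕ) := by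
    rcases Nat.eq_zero_or_pos (v : ℕ) with h0 | h0
    · rw [h0] at hv
      exact absurd (by simpa using hv) h
    · exact h0
  refine ⟨fun i => decide ((i : ℕ) / (v : ℕ) % 2 = 0), fun i j hc _ hp => ?_⟩
  have h1 : ((j : ℕ) : ZMod n) = (((i : ℕ) + (v : ℕ) : ℕ) : ZMod n) := by
    simp only [winPos] at hp
    push_cast
    linear_combination hp - hv
  have h2 := natCast_zmod_inj (by omega) (by omega) h1
  have h3 : (j : ℕ) / (v : ℕ) = (i : ℕ) / (v : ℕ) + 1 := by
    rw [h2, Nat.add_div_right _ hv0]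
  rw [decide_eq_decide, h3] at hc
  omega

/-- The phases whose windows overlap the window at phase `m`. -/
def nearPhases [NeZero n] (k : ℕ) (m : ZMod n) : Finset (ZMod n) :=
  Finset.univ.image (fun v : Fin k => m - ((v : ℕ) : ZMod n)) ∪
    Finset.univ.image (fun v : Fin k => m + ((v : ℕ) : ZMod n))

lemma card_nearPhases_le [NeZero n] (m : ZMod n) : (nearPhases k m).card ≤ 2 * k := by
  refine (Finset.card_union_le _ _).trans ?_
  have h1 := Finset.card_image_le (s := (Finset.univ : Finset (Fin k)))
    (f := fun v : Fin k => m - ((v : ℕ) : ZMod n))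
  have h2 := Finset.card_image_le (s := (Finset.univ : Finset (Fin k)))
    (f := fun v : Fin k => m + ((v : ℕ) : ZMod n))
  rw [Finset.card_fin] at h1 h2
  omega

lemma fwdFresh_of_notMem [NeZero n] {m m' : ZMod n} (h : m' ∉ nearPhases k m) :
    FwdFresh k m m' := by
  by_contra hc
  obtain ⟨v, hv⟩ := exists_of_not_fwdFresh hc
  refine h (Finset.mem_union_left _ (Finset.mem_image.mpr ⟨v, Finset.mem_univ _, ?_⟩))
  rw [← hv, add_sub_cancel_right]

lemma bwdFresh_of_notMem [NeZero n] {m m' : ZMod n} (h : m' ∉ nearPhases k m) :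
    BwdFresh k m m' := by
  by_contra hc
  obtain ⟨v, hv⟩ := exists_of_not_bwdFresh hc
  exact h (Finset.mem_union_right _ (Finset.mem_image.mpr ⟨v, Finset.mem_univ _, hv⟩))

end WinPos

/-- The product of the letter scores `s` over the windows at phases `m1`, `m2`. -/
def windowScore {X1 X2 Y : Type*} {n1 n2 k : ℕ} (s : X1 → X2 → Y → ℝ) (m1 : ZMod n1) (m2 : ZMod n2) (x1 : ZMod n1 → X1)
    (x2 : ZMod n2 → X2) (y : Fin k → Y) : ℝ :=
  ∏ i, s (x1 (winPos k m1 i)) (x2 (winPos k m2 i)) (y i)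

lemma windowScore_nonneg {X1 X2 Y : Type*} {n1 n2 k : ℕ} {s : X1 → X2 → Y → ℝ} (hs : ∀ a b y, 0 ≤ s a b y)
    (m1 : ZMod n1)
    (m2 : ZMod n2) (x1 : ZMod n1 → X1) (x2 : ZMod n2 → X2) (y : Fin k → Y) :
    0 ≤ windowScore s m1 m2 x1 x2 y :=
  Finset.prod_nonneg fun _ _ => hs _ _ _

/-- An exponential tilt with small parameter has mean below `1` if the exponent has negative
drift. -/
lemma exists_exp_tilt {ι : Type*} [Fintype ι] (q f : ι → ℝ) (hq : ∑ i, q i = 1) {c : ℝ}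
    (hc : c < ∑ i, q i * f i) :
    ∃ l : ℝ, 0 ≤ l ∧ ∑ i, q i * Real.exp (-l * (f i - c)) < 1 := by
  have hd : HasDerivAt (fun l : ℝ => ∑ i, q i * Real.exp (-l * (f i - c)))
      (∑ i, q i * (-(f i - c))) 0 := by
    refine HasDerivAt.fun_sum fun i _ => ?_
    have h1 : HasDerivAt (fun l : ℝ => -l * (f i - c)) (-(f i - c)) 0 := by
      simpa using (hasDerivAt_id (0 : ℝ)).neg.mul_const (f i - c)
    simpa using h1.exp.const_mul (q i)
  have hneg : ∑ i, q i * (-(f i - c)) < 0 := by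
    have : ∑ i, q i * (-(f i - c)) = c * ∑ i, q i - ∑ i, q i * f i := by
      rw [Finset.mul_sum, ← Finset.sum_sub_distrib]
      exact Finset.sum_congr rfl fun i _ => by ring
    rw [this, hq]
    linarith
  have hev := hd.tendsto_slope_zero_right.eventually (gt_mem_nhds hneg)
  obtain ⟨l, hl, hl0⟩ := (hev.and self_mem_nhdsWithin).exists
  refine ⟨l, (Set.mem_Ioi.mp hl0).le, ?_⟩
  have h := (smul_neg_iff_of_pos_left (inv_pos.mpr (Set.mem_Ioi.mp hl0))).mp hl
  simpa [hq] using h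

section ErrorBounds

variable {X1 X2 Y : Type*} [Fintype X1] [Fintype X2] [Fintype Y]
  {W : X1 → X2 → Y → ℝ} {p1 : X1 → ℝ} {p2 : X2 → ℝ} {n1 n2 k : ℕ} [NeZero n1] [NeZero n2]

/-- **Markov's inequality** for `jointAvg`. -/
lemma jointAvg_boolReal_le (hW0 : ∀ a b y, 0 ≤ W a b y) (hp10 : ∀ a, 0 ≤ p1 a)
    (hp20 : ∀ b, 0 ≤ p2 b) {ι1 ι2 κ : Type*} [Fintype ι1] [Fintype ι2] [Fintype κ]
    [DecidableEq ι1] [DecidableEq ι2] [DecidableEq κ] {u1 : κ → ι1} {u2 : κ → ι2}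
    {F : (ι1 → X1) → (ι2 → X2) → (κ → Y) → ℝ} (hF : ∀ x1 x2 y, 0 ≤ F x1 x2 y) {T c : ℝ}
    (hT : 0 < T) (hc : jointAvg W p1 p2 u1 u2 F ≤ c) :
    jointAvg W p1 p2 u1 u2 (fun x1 x2 y => boolReal (T ≤ F x1 x2 y)) ≤ c * T⁻¹ := by
  refine le_trans ?_ (mul_le_mul_of_nonneg_right hc (inv_nonneg.mpr hT.le))
  rw [← jointAvg_mul_const]
  refine jointAvg_mono hW0 hp10 hp20 fun x1 x2 y _ => ?_
  by_cases h : T ≤ F x1 x2 y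
  · rw [boolReal_pos h, ← div_eq_mul_inv]
    exact (one_le_div hT).mpr h
  · rw [boolReal_neg h]
    exact mul_nonneg (hF _ _ _) (inv_nonneg.mpr hT.le)

lemma jointAvg_windowScore_le_one (hW0 : ∀ a b y, 0 ≤ W a b y) (hW1 : ∀ a b, ∑ y, W a b y = 1)
    (hp10 : ∀ a, 0 ≤ p1 a) (hp11 : ∑ a, p1 a = 1)
    (hp20 : ∀ b, 0 ≤ p2 b) (hp21 : ∑ b, p2 b = 1) (hk1 : k ≤ n1) (hk2 : k ≤ n2)
    {s : X1 → X2 → Y → ℝ} (hs : ∀ a b y, 0 ≤ s a b y) {m1 m1' : ZMod n1} {m2 m2' : ZMod n2}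
    (hfresh : (FwdFresh k m1 m1' ∨ m1' = m1) ∧ (FwdFresh k m2 m2' ∨ m2' = m2) ∨
      (BwdFresh k m1 m1' ∨ m1' = m1) ∧ (BwdFresh k m2 m2' ∨ m2' = m2))
    (hsum : ∀ i (x1 : ZMod n1 → X1) (x2 : ZMod n2 → X2), ∑ a, ∑ b, p1 a * p2 b * ∑ y, W a b y *
      s (Function.update x1 (winPos k m1 i) a (winPos k m1' i))
        (Function.update x2 (winPos k m2 i) b (winPos k m2' i)) y ≤ 1) :
    jointAvg W p1 p2 (winPos k m1) (winPos k m2) (windowScore s m1' m2') ≤ 1 := by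
  have aux : ∀ key : Fin k → ℤ,
      (∀ i j, j ≠ i → key j ≤ key i → winPos k m1' j ≠ winPos k m1 i) →
      (∀ i j, j ≠ i → key j ≤ key i → winPos k m2' j ≠ winPos k m2 i) →
      jointAvg W p1 p2 (winPos k m1) (winPos k m2) (windowScore s m1' m2') ≤ 1 := by
    intro key h1 h2
    have h := jointAvg_prod_le hW0 hW1 hp10 hp11 hp20 hp21
      (winPos_injective hk1 m1) (winPos_injective hk2 m2) (winPos k m1') (winPos k m2') hs key
      zero_le_one Finset.univ (fun i _ => hsum i) (fun i _ j _ => h1 i j) (fun i _ j _ => h2 i j)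
    rw [one_pow] at h
    exact h
  rcases hfresh with ⟨h1, h2⟩ | ⟨h1, h2⟩
  · refine aux (fun i => -((i : ℕ) : ℤ)) (fun i j hij hk => ?_) (fun i j hij hk => ?_)
    · rcases h1 with h | rfl
      · exact h i j (Fin.le_def.mpr (by omega))
      · exact (winPos_injective hk1 _).ne hij
    · rcases h2 with h | rfl
      · exact h i j (Fin.le_def.mpr (by omega))
      · exact (winPos_injective hk2 _).ne hij
  · refine aux (fun i => ((i : ℕ) : ℤ)) (fun i j hij hk => ?_) (fun i j hij hk => ?_)
    · rcases h1 with h | rfl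
      · exact h i j (Fin.le_def.mpr (by omega))
      · exact (winPos_injective hk1 _).ne hij
    · rcases h2 with h | rfl
      · exact h i j (Fin.le_def.mpr (by omega))
      · exact (winPos_injective hk2 _).ne hij

/-- A wrong first phase with the correct second phase passes the test with probability at most
`T⁻¹`. -/
lemma jointAvg_wrong_fst_le (hW0 : ∀ a b y, 0 ≤ W a b y) (hW1 : ∀ a b, ∑ y, W a b y = 1)
    (hp10 : ∀ a, 0 ≤ p1 a) (hp11 : ∑ a, p1 a = 1)
    (hp20 : ∀ b, 0 ≤ p2 b) (hp21 : ∑ b, p2 b = 1) (hk1 : 2 * k ≤ n1) (hk2 : k ≤ n2)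
    {s : X1 → X2 → Y → ℝ} (hs : ∀ a b y, 0 ≤ s a b y)
    (hsum : ∀ a', ∑ a, ∑ b, p1 a * p2 b * ∑ y, W a b y * s a' b y ≤ 1)
    {m1 m1' : ZMod n1} (m2 : ZMod n2) (h1 : m1' ≠ m1) {T : ℝ} (hT : 0 < T) :
    jointAvg W p1 p2 (winPos k m1) (winPos k m2)
      (fun x1 x2 y => boolReal (T ≤ windowScore s m1' m2 x1 x2 y)) ≤ T⁻¹ := by
  have h := jointAvg_boolReal_le hW0 hp10 hp20
    (windowScore_nonneg hs m1' m2) hT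
    (jointAvg_windowScore_le_one hW0 hW1 hp10 hp11 hp20 hp21 (by omega) hk2 hs
      (m1 := m1) (m1' := m1') (m2 := m2) (m2' := m2) (k := k)
      ((fwdFresh_or_bwdFresh hk1 h1).imp (fun h => ⟨.inl h, .inr rfl⟩)
        fun h => ⟨.inl h, .inr rfl⟩) ?_)
  · simpa using h
  · intro i x1 x2
    simpa only [Function.update_of_ne (winPos_ne h1 i), Function.update_self] using hsum _

/-- A wrong second phase with the correct first phase passes the test with probability at most
`T⁻¹`. -/
lemma jointAvg_wrong_snd_le (hW0 : ∀ a b y, 0 ≤ W a b y) (hW1 : ∀ a b, ∑ y, W a b y = 1)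
    (hp10 : ∀ a, 0 ≤ p1 a) (hp11 : ∑ a, p1 a = 1)
    (hp20 : ∀ b, 0 ≤ p2 b) (hp21 : ∑ b, p2 b = 1) (hk1 : k ≤ n1) (hk2 : 2 * k ≤ n2)
    {s : X1 → X2 → Y → ℝ} (hs : ∀ a b y, 0 ≤ s a b y)
    (hsum : ∀ b', ∑ a, ∑ b, p1 a * p2 b * ∑ y, W a b y * s a b' y ≤ 1)
    (m1 : ZMod n1) {m2 m2' : ZMod n2} (h2 : m2' ≠ m2) {T : ℝ} (hT : 0 < T) :
    jointAvg W p1 p2 (winPos k m1) (winPos k m2)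
      (fun x1 x2 y => boolReal (T ≤ windowScore s m1 m2' x1 x2 y)) ≤ T⁻¹ := by
  have h := jointAvg_boolReal_le hW0 hp10 hp20
    (windowScore_nonneg hs m1 m2') hT
    (jointAvg_windowScore_le_one hW0 hW1 hp10 hp11 hp20 hp21 hk1 (by omega) hs
      (m1 := m1) (m1' := m1) (m2 := m2) (m2' := m2') (k := k)
      ((fwdFresh_or_bwdFresh hk2 h2).imp (fun h => ⟨.inr rfl, .inl h⟩)
        fun h => ⟨.inr rfl, .inl h⟩) ?_)
  · simpa using h
  · intro i x1 x2
    simpa only [Function.update_of_ne (winPos_ne h2 i), Function.update_self] using hsum _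

/-- Two wrong phases, at least one of them away from the correct one, pass the test with
probability at most `T⁻¹`. -/
lemma jointAvg_wrong_far_le (hW0 : ∀ a b y, 0 ≤ W a b y) (hW1 : ∀ a b, ∑ y, W a b y = 1)
    (hp10 : ∀ a, 0 ≤ p1 a) (hp11 : ∑ a, p1 a = 1)
    (hp20 : ∀ b, 0 ≤ p2 b) (hp21 : ∑ b, p2 b = 1) (hk1 : 2 * k ≤ n1) (hk2 : 2 * k ≤ n2)
    {s : X1 → X2 → Y → ℝ} (hs : ∀ a b y, 0 ≤ s a b y)
    (hsum : ∀ a' b', ∑ a, ∑ b, p1 a * p2 b * ∑ y, W a b y * s a' b' y ≤ 1)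
    {m1 m1' : ZMod n1} {m2 m2' : ZMod n2} (h1 : m1' ≠ m1) (h2 : m2' ≠ m2)
    (hfar : m1' ∉ nearPhases k m1 ∨ m2' ∉ nearPhases k m2) {T : ℝ} (hT : 0 < T) :
    jointAvg W p1 p2 (winPos k m1) (winPos k m2)
      (fun x1 x2 y => boolReal (T ≤ windowScore s m1' m2' x1 x2 y)) ≤ T⁻¹ := by
  have h := jointAvg_boolReal_le hW0 hp10 hp20
    (windowScore_nonneg hs m1' m2') hT
    (jointAvg_windowScore_le_one hW0 hW1 hp10 hp11 hp20 hp21 (by omega) (by omega) hs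
      (m1 := m1) (m1' := m1') (m2 := m2) (m2' := m2') (k := k) ?_ ?_)
  · simpa using h
  · rcases hfar with hfar | hfar
    · exact (fwdFresh_or_bwdFresh hk2 h2).imp
        (fun h => ⟨.inl (fwdFresh_of_notMem hfar), .inl h⟩)
        fun h => ⟨.inl (bwdFresh_of_notMem hfar), .inl h⟩
    · exact (fwdFresh_or_bwdFresh hk1 h1).imp
        (fun h => ⟨.inl h, .inl (fwdFresh_of_notMem hfar)⟩)
        fun h => ⟨.inl h, .inl (bwdFresh_of_notMem hfar)⟩
  · intro i x1 x2
    simpa only [Function.update_of_ne (winPos_ne h1 i), Function.update_of_ne (winPos_ne h2 i)]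
      using hsum _ _

/-- Any two wrong phases pass the test at level `t ^ 4` with probability at most `4 * t⁻¹`. -/
lemma jointAvg_wrong_near_le (hW0 : ∀ a b y, 0 ≤ W a b y) (hW1 : ∀ a b, ∑ y, W a b y = 1)
    (hp10 : ∀ a, 0 ≤ p1 a) (hp11 : ∑ a, p1 a = 1)
    (hp20 : ∀ b, 0 ≤ p2 b) (hp21 : ∑ b, p2 b = 1) (hk1 : 2 * k ≤ n1) (hk2 : 2 * k ≤ n2)
    {s : X1 → X2 → Y → ℝ} (hs : ∀ a b y, 0 ≤ s a b y)
    (hsum : ∀ a' b', ∑ a, ∑ b, p1 a * p2 b * ∑ y, W a b y * s a' b' y ≤ 1)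
    {m1 m1' : ZMod n1} {m2 m2' : ZMod n2} (h1 : m1' ≠ m1) (h2 : m2' ≠ m2) {t : ℝ} (ht : 0 < t) :
    jointAvg W p1 p2 (winPos k m1) (winPos k m2)
      (fun x1 x2 y => boolReal (t ^ 4 ≤ windowScore s m1' m2' x1 x2 y)) ≤ 4 * t⁻¹ := by
  obtain ⟨c1, hc1⟩ := exists_fresh_coloring hk1 h1
  obtain ⟨c2, hc2⟩ := exists_fresh_coloring hk2 h2
  let cell : Bool × Bool → Finset (Fin k) := fun e => {i | (c1 i, c2 i) = e}
  let part : Bool × Bool → (ZMod n1 → X1) → (ZMod n2 → X2) → (Fin k → Y) → ℝ :=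
    fun e x1 x2 y => ∏ i ∈ cell e, s (x1 (winPos k m1' i)) (x2 (winPos k m2' i)) (y i)
  have hpart0 : ∀ e x1 x2 y, 0 ≤ part e x1 x2 y :=
    fun e x1 x2 y => Finset.prod_nonneg fun _ _ => hs _ _ _
  have hpart : ∀ e, jointAvg W p1 p2 (winPos k m1) (winPos k m2) (part e) ≤ 1 := by
    intro e
    rw [← one_pow (cell e).card]
    refine jointAvg_prod_le hW0 hW1 hp10 hp11 hp20 hp21
      (winPos_injective (by omega) m1) (winPos_injective (by omega) m2) (winPos k m1')
      (winPos k m2') hs (fun i => -((i : ℕ) : ℤ)) zero_le_one (cell e) ?_ ?_ ?_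
    · intro i _ x1 x2
      simpa only [Function.update_of_ne (winPos_ne h1 i), Function.update_of_ne (winPos_ne h2 i)]
        using hsum _ _
    · intro i hi j hj _ hk
      have hij := ((Finset.mem_filter.mp hi).2).trans ((Finset.mem_filter.mp hj).2).symm
      exact hc1 i j (congrArg Prod.fst hij) (Fin.le_def.mpr (by omega))
    · intro i hi j hj _ hk
      have hij := ((Finset.mem_filter.mp hi).2).trans ((Finset.mem_filter.mp hj).2).symm
      exact hc2 i j (congrArg Prod.snd hij) (Fin.le_def.mpr (by omega))
  have hprod : ∀ x1 x2 y, windowScore s m1' m2' x1 x2 y = ∏ e, part e x1 x2 y := fun x1 x2 y =>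
    (Finset.prod_fiberwise Finset.univ (fun i => (c1 i, c2 i))
      (fun i => s (x1 (winPos k m1' i)) (x2 (winPos k m2' i)) (y i))).symm
  calc _ ≤ jointAvg W p1 p2 (winPos k m1) (winPos k m2)
        (fun x1 x2 y => ∑ e, boolReal (t ≤ part e x1 x2 y)) := by
        refine jointAvg_mono hW0 hp10 hp20 fun x1 x2 y _ => ?_
        have hnn : ∀ e ∈ Finset.univ, 0 ≤ boolReal (t ≤ part e x1 x2 y) :=
          fun _ _ => boolReal_nonneg _
        by_cases hall : ∃ e, t ≤ part e x1 x2 y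
        · obtain ⟨e, he⟩ := hall
          have hle := Finset.single_le_sum hnn (Finset.mem_univ e)
          rw [boolReal_pos he] at hle
          refine le_trans ?_ hle
          by_cases h : t ^ 4 ≤ windowScore s m1' m2' x1 x2 y
          · rw [boolReal_pos h]
          · rw [boolReal_neg h]; exact zero_le_one
        · push Not at hall
          rw [boolReal_neg]
          · exact Finset.sum_nonneg hnn
          · rw [hprod, not_le]
            have : ∏ e, part e x1 x2 y < ∏ _e : Bool × Bool, t := by
              by_cases h0 : ∃ e, part e x1 x2 y = 0
              · obtain ⟨e, he⟩ := h0
                rw [Finset.prod_eq_zero (Finset.mem_univ e) he]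
                exact Finset.prod_pos fun _ _ => ht
              · push Not at h0
                exact Finset.prod_lt_prod_of_nonempty
                  (fun e _ => lt_of_le_of_ne (hpart0 e x1 x2 y) (h0 e).symm)
                  (fun e _ => hall e) Finset.univ_nonempty
            simpa using this
    _ = ∑ e, jointAvg W p1 p2 (winPos k m1) (winPos k m2)
        (fun x1 x2 y => boolReal (t ≤ part e x1 x2 y)) := jointAvg_sum _ _
    _ ≤ ∑ _e : Bool × Bool, 1 * t⁻¹ := Finset.sum_le_sum fun e _ =>
        jointAvg_boolReal_le hW0 hp10 hp20 (hpart0 e) ht (hpart e)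
    _ = 4 * t⁻¹ := by simp

/-- Chernoff bound for the probability that the correct phases fail the test. -/
lemma jointAvg_correct_le (hW0 : ∀ a b y, 0 ≤ W a b y) (hW1 : ∀ a b, ∑ y, W a b y = 1)
    (hp10 : ∀ a, 0 ≤ p1 a) (hp11 : ∑ a, p1 a = 1)
    (hp20 : ∀ b, 0 ≤ p2 b) (hp21 : ∑ b, p2 b = 1) (hk1 : k ≤ n1) (hk2 : k ≤ n2)
    {r : X1 → X2 → Y → ℝ} (hr : ∀ a b y, 0 < p1 a * p2 b * W a b y → 0 < r a b y)
    {c l : ℝ} (hl : 0 ≤ l) (m1 : ZMod n1) (m2 : ZMod n2) :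
    jointAvg W p1 p2 (winPos k m1) (winPos k m2)
      (fun x1 x2 y => boolReal (¬(2 : ℝ) ^ (c * k) ≤ windowScore r m1 m2 x1 x2 y)) ≤
      (∑ a, ∑ b, ∑ y, p1 a * p2 b * W a b y * Real.exp (-l * (Real.logb 2 (r a b y) - c))) ^ k := by
  have hmain := jointAvg_prod_le hW0 hW1 hp10 hp11 hp20 hp21 (winPos_injective hk1 m1)
    (winPos_injective hk2 m2) (winPos k m1) (winPos k m2)
    (s := fun a b y => Real.exp (-l * (Real.logb 2 (r a b y) - c)))
    (fun _ _ _ => (Real.exp_pos _).le) (fun _ => 0)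
    (c := ∑ a, ∑ b, ∑ y, p1 a * p2 b * W a b y * Real.exp (-l * (Real.logb 2 (r a b y) - c)))
    (Finset.sum_nonneg fun a _ => Finset.sum_nonneg fun b _ => Finset.sum_nonneg fun y _ =>
      mul_nonneg (mul_nonneg (mul_nonneg (hp10 a) (hp20 b)) (hW0 a b y)) (Real.exp_pos _).le)
    Finset.univ
    (fun i _ x1 x2 => by simp only [Function.update_self, Finset.mul_sum, mul_assoc]; exact le_rfl)
    (fun i _ j _ hij _ => (winPos_injective hk1 m1).ne hij)
    (fun i _ j _ hij _ => (winPos_injective hk2 m2).ne hij)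
  rw [Finset.card_fin] at hmain
  refine le_trans (jointAvg_mono hW0 hp10 hp20 fun x1 x2 y hpos => ?_) hmain
  by_cases h : (2 : ℝ) ^ (c * k) ≤ windowScore r m1 m2 x1 x2 y
  · rw [boolReal_neg (not_not.mpr h)]
    exact Finset.prod_nonneg fun _ _ => (Real.exp_pos _).le
  · rw [boolReal_pos h, ← Real.exp_sum]
    refine Real.one_le_exp ?_
    rw [← Finset.mul_sum, Finset.sum_sub_distrib]
    have hrpos : ∀ i, 0 < r (x1 (winPos k m1 i)) (x2 (winPos k m2 i)) (y i) :=
      fun i => hr _ _ _ (hpos i)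
    have hlog : ∑ i, Real.logb 2 (r (x1 (winPos k m1 i)) (x2 (winPos k m2 i)) (y i)) =
        Real.logb 2 (windowScore r m1 m2 x1 x2 y) := by
      rw [windowScore, Real.logb_prod _ _ fun i _ => (hrpos i).ne']
    have hlt : Real.logb 2 (windowScore r m1 m2 x1 x2 y) < c * k :=
      (Real.logb_lt_iff_lt_rpow one_lt_two (Finset.prod_pos fun i _ => hrpos i)).mpr (not_le.mp h)
    rw [hlog, Finset.sum_const, Finset.card_fin, nsmul_eq_mul]
    nlinarith

end ErrorBounds

/-- The phases `m` pass the three threshold tests for the output `y`. -/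
def Accepts {X1 X2 Y : Type*} {n1 n2 k : ℕ} (r1 r2 r12 : X1 → X2 → Y → ℝ) (T1 T2 T12 : ℝ)
    (x1 : ZMod n1 → X1) (x2 : ZMod n2 → X2) (y : Fin k → Y) (m : ZMod n1 × ZMod n2) : Prop :=
  T1 ≤ windowScore r1 m.1 m.2 x1 x2 y ∧ T2 ≤ windowScore r2 m.1 m.2 x1 x2 y ∧
    T12 ≤ windowScore r12 m.1 m.2 x1 x2 y

/-- The phases `m` are not the only ones that pass the three threshold tests. -/
def Confused {X1 X2 Y : Type*} {n1 n2 k : ℕ} (r1 r2 r12 : X1 → X2 → Y → ℝ) (T1 T2 T12 : ℝ)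
    (x1 : ZMod n1 → X1) (x2 : ZMod n2 → X2) (y : Fin k → Y) (m : ZMod n1 × ZMod n2) : Prop :=
  ¬Accepts r1 r2 r12 T1 T2 T12 x1 x2 y m ∨
    ∃ m', m' ≠ m ∧ Accepts r1 r2 r12 T1 T2 T12 x1 x2 y m'

/-- A detector that errs only when the correct phases are confused. -/
lemma exists_detector {X1 X2 Y : Type*} {n1 n2 k : ℕ} (r1 r2 r12 : X1 → X2 → Y → ℝ)
    (T1 T2 T12 : ℝ) (x1 : ZMod n1 → X1) (x2 : ZMod n2 → X2) :
    ∃ g : (Fin k → Y) → ZMod n1 × ZMod n2, ∀ y m, g y ≠ m →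
      Confused r1 r2 r12 T1 T2 T12 x1 x2 y m := by
  classical
  refine ⟨fun y => if h : ∃ m, Accepts r1 r2 r12 T1 T2 T12 x1 x2 y m then h.choose else 0,
    fun y m hg => ?_⟩
  by_cases hm : Accepts r1 r2 r12 T1 T2 T12 x1 x2 y m
  · have h : ∃ m, Accepts r1 r2 r12 T1 T2 T12 x1 x2 y m := ⟨m, hm⟩
    simp only [h, dite_true] at hg
    exact .inr ⟨_, hg, h.choose_spec⟩
  · exact .inl hm

section Decoding

variable {X1 X2 Y : Type*} {n1 n2 k : ℕ} [NeZero n1] [NeZero n2]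

lemma boolReal_confused_le (r1 r2 r12 : X1 → X2 → Y → ℝ) (T1 T2 T12 : ℝ) (x1 : ZMod n1 → X1)
    (x2 : ZMod n2 → X2) (y : Fin k → Y) (m1 : ZMod n1) (m2 : ZMod n2) :
    boolReal (Confused r1 r2 r12 T1 T2 T12 x1 x2 y (m1, m2)) ≤
      boolReal (¬T1 ≤ windowScore r1 m1 m2 x1 x2 y) +
      boolReal (¬T2 ≤ windowScore r2 m1 m2 x1 x2 y) +
      boolReal (¬T12 ≤ windowScore r12 m1 m2 x1 x2 y) +
      ∑ m1' ∈ Finset.univ.erase m1, boolReal (T1 ≤ windowScore r1 m1' m2 x1 x2 y) +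
      ∑ m2' ∈ Finset.univ.erase m2, boolReal (T2 ≤ windowScore r2 m1 m2' x1 x2 y) +
      ∑ m1' ∈ Finset.univ.erase m1, ∑ m2' ∈ Finset.univ.erase m2,
        boolReal (T12 ≤ windowScore r12 m1' m2' x1 x2 y) := by
  have n1' := boolReal_nonneg (¬T1 ≤ windowScore r1 m1 m2 x1 x2 y)
  have n2' := boolReal_nonneg (¬T2 ≤ windowScore r2 m1 m2 x1 x2 y)
  have n3' := boolReal_nonneg (¬T12 ≤ windowScore r12 m1 m2 x1 x2 y)
  have n4' : 0 ≤ ∑ m1' ∈ Finset.univ.erase m1, boolReal (T1 ≤ windowScore r1 m1' m2 x1 x2 y) :=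
    Finset.sum_nonneg fun _ _ => boolReal_nonneg _
  have n5' : 0 ≤ ∑ m2' ∈ Finset.univ.erase m2, boolReal (T2 ≤ windowScore r2 m1 m2' x1 x2 y) :=
    Finset.sum_nonneg fun _ _ => boolReal_nonneg _
  have n6' : 0 ≤ ∑ m1' ∈ Finset.univ.erase m1, ∑ m2' ∈ Finset.univ.erase m2,
        boolReal (T12 ≤ windowScore r12 m1' m2' x1 x2 y) :=
    Finset.sum_nonneg fun _ _ => Finset.sum_nonneg fun _ _ => boolReal_nonneg _
  by_cases hc : Confused r1 r2 r12 T1 T2 T12 x1 x2 y (m1, m2)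
  swap
  · rw [boolReal_neg hc]
    positivity
  rw [boolReal_pos hc]
  rcases hc with hc | ⟨⟨m1', m2'⟩, hne, h1, h2, h12⟩
  · simp only [Accepts, not_and_or] at hc
    rcases hc with h | h | h <;> rw [boolReal_pos h] <;> linarith
  · by_cases e1 : m1' = m1
    · subst e1
      have e2 : m2' ≠ m2 := fun h => hne (by rw [h])
      have hle := Finset.single_le_sum
        (f := fun m2' => boolReal (T2 ≤ windowScore r2 m1' m2' x1 x2 y))
        (fun _ _ => boolReal_nonneg _) (Finset.mem_erase.mpr ⟨e2, Finset.mem_univ _⟩)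
      simp only [boolReal_pos h2] at hle
      linarith
    by_cases e2 : m2' = m2
    · subst e2
      have hle := Finset.single_le_sum
        (f := fun m1' => boolReal (T1 ≤ windowScore r1 m1' m2' x1 x2 y))
        (fun _ _ => boolReal_nonneg _) (Finset.mem_erase.mpr ⟨e1, Finset.mem_univ _⟩)
      simp only [boolReal_pos h1] at hle
      linarith
    · have hle1 := Finset.single_le_sum
        (f := fun m2' => boolReal (T12 ≤ windowScore r12 m1' m2' x1 x2 y))
        (fun _ _ => boolReal_nonneg _) (Finset.mem_erase.mpr ⟨e2, Finset.mem_univ _⟩)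
      have hle2 := Finset.single_le_sum
        (f := fun m1' => ∑ m2' ∈ Finset.univ.erase m2,
          boolReal (T12 ≤ windowScore r12 m1' m2' x1 x2 y))
        (fun _ _ => Finset.sum_nonneg fun _ _ => boolReal_nonneg _)
        (Finset.mem_erase.mpr ⟨e1, Finset.mem_univ _⟩)
      simp only [boolReal_pos h12] at hle1
      linarith

variable [Fintype X1] [Fintype X2] [Fintype Y] {W : X1 → X2 → Y → ℝ} {p1 : X1 → ℝ} {p2 : X2 → ℝ}

/-- Average probability over random sequences that the correct phases are confused. -/
lemma jointAvg_confused_le (hW0 : ∀ a b y, 0 ≤ W a b y) (hW1 : ∀ a b, ∑ y, W a b y = 1)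
    (hp10 : ∀ a, 0 ≤ p1 a) (hp11 : ∑ a, p1 a = 1)
    (hp20 : ∀ b, 0 ≤ p2 b) (hp21 : ∑ b, p2 b = 1) (hk1 : 2 * k ≤ n1) (hk2 : 2 * k ≤ n2)
    {r1 r2 r12 : X1 → X2 → Y → ℝ} (hr1 : ∀ a b y, 0 ≤ r1 a b y) (hr2 : ∀ a b y, 0 ≤ r2 a b y)
    (hr12 : ∀ a b y, 0 ≤ r12 a b y)
    (hsum1 : ∀ a', ∑ a, ∑ b, p1 a * p2 b * ∑ y, W a b y * r1 a' b y ≤ 1)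
    (hsum2 : ∀ b', ∑ a, ∑ b, p1 a * p2 b * ∑ y, W a b y * r2 a b' y ≤ 1)
    (hsum12 : ∀ a' b', ∑ a, ∑ b, p1 a * p2 b * ∑ y, W a b y * r12 a' b' y ≤ 1)
    (m1 : ZMod n1) (m2 : ZMod n2) {T1 T2 t : ℝ} (hT1 : 0 < T1) (hT2 : 0 < T2) (ht : 0 < t)
    {e1 e2 e12 : ℝ}
    (he1 : jointAvg W p1 p2 (winPos k m1) (winPos k m2)
      (fun x1 x2 y => boolReal (¬T1 ≤ windowScore r1 m1 m2 x1 x2 y)) ≤ e1)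
    (he2 : jointAvg W p1 p2 (winPos k m1) (winPos k m2)
      (fun x1 x2 y => boolReal (¬T2 ≤ windowScore r2 m1 m2 x1 x2 y)) ≤ e2)
    (he12 : jointAvg W p1 p2 (winPos k m1) (winPos k m2)
      (fun x1 x2 y => boolReal (¬t ^ 4 ≤ windowScore r12 m1 m2 x1 x2 y)) ≤ e12) :
    jointAvg W p1 p2 (winPos k m1) (winPos k m2)
      (fun x1 x2 y => boolReal (Confused r1 r2 r12 T1 T2 (t ^ 4) x1 x2 y (m1, m2))) ≤
      e1 + e2 + e12 + n1 * T1⁻¹ + n2 * T2⁻¹ +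
        (n1 * n2 * (t ^ 4)⁻¹ + (2 * k) ^ 2 * (4 * t⁻¹)) := by
  refine (jointAvg_mono hW0 hp10 hp20 fun x1 x2 y _ =>
    boolReal_confused_le r1 r2 r12 T1 T2 (t ^ 4) x1 x2 y m1 m2).trans ?_
  simp only [jointAvg_add, jointAvg_sum]
  have b1 : ∑ m1' ∈ Finset.univ.erase m1, jointAvg W p1 p2 (winPos k m1) (winPos k m2)
      (fun x1 x2 y => boolReal (T1 ≤ windowScore r1 m1' m2 x1 x2 y)) ≤ n1 * T1⁻¹ := by
    refine (Finset.sum_le_card_nsmul _ _ T1⁻¹ fun m1' hm => jointAvg_wrong_fst_le hW0 hW1 hp10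
      hp11 hp20 hp21 hk1 (by omega) hr1 hsum1 m2 (Finset.ne_of_mem_erase hm) hT1).trans ?_
    rw [nsmul_eq_mul]
    refine mul_le_mul_of_nonneg_right ?_ (inv_nonneg.mpr hT1.le)
    exact_mod_cast (Finset.card_le_univ _).trans (ZMod.card n1).le
  have b2 : ∑ m2' ∈ Finset.univ.erase m2, jointAvg W p1 p2 (winPos k m1) (winPos k m2)
      (fun x1 x2 y => boolReal (T2 ≤ windowScore r2 m1 m2' x1 x2 y)) ≤ n2 * T2⁻¹ := by
    refine (Finset.sum_le_card_nsmul _ _ T2⁻¹ fun m2' hm => jointAvg_wrong_snd_le hW0 hW1 hp10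
      hp11 hp20 hp21 (by omega) hk2 hr2 hsum2 m1 (Finset.ne_of_mem_erase hm) hT2).trans ?_
    rw [nsmul_eq_mul]
    refine mul_le_mul_of_nonneg_right ?_ (inv_nonneg.mpr hT2.le)
    exact_mod_cast (Finset.card_le_univ _).trans (ZMod.card n2).le
  have b12 : ∑ m1' ∈ Finset.univ.erase m1, ∑ m2' ∈ Finset.univ.erase m2,
      jointAvg W p1 p2 (winPos k m1) (winPos k m2)
        (fun x1 x2 y => boolReal (t ^ 4 ≤ windowScore r12 m1' m2' x1 x2 y)) ≤
      n1 * n2 * (t ^ 4)⁻¹ + (2 * k) ^ 2 * (4 * t⁻¹) := by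
    have hT := inv_nonneg.mpr (pow_pos ht 4).le
    have ht' : 0 ≤ 4 * t⁻¹ := by positivity
    have hbound : ∀ m1' ∈ Finset.univ.erase m1, ∀ m2' ∈ Finset.univ.erase m2,
        jointAvg W p1 p2 (winPos k m1) (winPos k m2)
          (fun x1 x2 y => boolReal (t ^ 4 ≤ windowScore r12 m1' m2' x1 x2 y)) ≤
        (t ^ 4)⁻¹ + if m1' ∈ nearPhases k m1 then
          (if m2' ∈ nearPhases k m2 then 4 * t⁻¹ else 0) else 0 := by
      intro m1' hm1 m2' hm2
      by_cases hn : m1' ∈ nearPhases k m1 ∧ m2' ∈ nearPhases k m2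
      · rw [if_pos hn.1, if_pos hn.2]
        exact (jointAvg_wrong_near_le hW0 hW1 hp10 hp11 hp20 hp21 hk1 hk2 hr12 hsum12
          (Finset.ne_of_mem_erase hm1) (Finset.ne_of_mem_erase hm2) ht).trans
          (le_add_of_nonneg_left hT)
      · refine (jointAvg_wrong_far_le hW0 hW1 hp10 hp11 hp20 hp21 hk1 hk2 hr12 hsum12
          (Finset.ne_of_mem_erase hm1) (Finset.ne_of_mem_erase hm2) (not_and_or.mp hn)
          (pow_pos ht 4)).trans (le_add_of_nonneg_right ?_)
        split_ifs <;> first | exact ht' | exact le_rfl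
    have hnn : ∀ m1' m2', 0 ≤ (t ^ 4)⁻¹ + if m1' ∈ nearPhases k m1 then
          (if m2' ∈ nearPhases k m2 then 4 * t⁻¹ else 0) else 0 := by
      intro m1' m2'
      refine add_nonneg hT ?_
      split_ifs <;> first | exact ht' | exact le_rfl
    refine (Finset.sum_le_sum fun m1' h1 => Finset.sum_le_sum fun m2' h2 =>
      hbound m1' h1 m2' h2).trans ?_
    refine (Finset.sum_le_sum fun m1' _ => Finset.sum_le_sum_of_subset_of_nonneg
      (Finset.erase_subset _ _) fun m2' _ _ => hnn m1' m2').trans ?_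
    refine (Finset.sum_le_sum_of_subset_of_nonneg (Finset.erase_subset _ _) fun m1' _ _ =>
      Finset.sum_nonneg fun m2' _ => hnn m1' m2').trans ?_
    have hcard1 : ((nearPhases k m1).card : ℝ) ≤ 2 * k := by
      exact_mod_cast card_nearPhases_le m1
    have hcard2 : ((nearPhases k m2).card : ℝ) ≤ 2 * k := by
      exact_mod_cast card_nearPhases_le m2
    have hcalc : ∑ m1' : ZMod n1, ∑ m2' : ZMod n2, ((t ^ 4)⁻¹ + if m1' ∈ nearPhases k m1 then
          (if m2' ∈ nearPhases k m2 then 4 * t⁻¹ else 0) else 0) = n1 * n2 * (t ^ 4)⁻¹ +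
          ((nearPhases k m1).card * (nearPhases k m2).card) * (4 * t⁻¹) := by
      have hin : ∀ m1' : ZMod n1, ∑ m2' : ZMod n2, ((t ^ 4)⁻¹ + if m1' ∈ nearPhases k m1 then
          (if m2' ∈ nearPhases k m2 then 4 * t⁻¹ else 0) else 0) = n2 * (t ^ 4)⁻¹ +
          if m1' ∈ nearPhases k m1 then (nearPhases k m2).card * (4 * t⁻¹) else 0 := by
        intro m1'
        rw [Finset.sum_add_distrib]
        split_ifs <;> simp [ZMod.card]
      simp only [hin]
      rw [Finset.sum_add_distrib, Finset.sum_ite_mem]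
      simp only [Finset.sum_const, Finset.card_univ, ZMod.card, nsmul_eq_mul, Finset.univ_inter]
      ring
    rw [hcalc, sq]
    gcongr
  linarith

/-- For any rate below the mean log-score, the correct phases fail the threshold test with
exponentially small probability. -/
lemma exists_jointAvg_correct_le (hW0 : ∀ a b y, 0 ≤ W a b y) (hW1 : ∀ a b, ∑ y, W a b y = 1)
    (hp10 : ∀ a, 0 ≤ p1 a) (hp11 : ∑ a, p1 a = 1)
    (hp20 : ∀ b, 0 ≤ p2 b) (hp21 : ∑ b, p2 b = 1)
    {r : X1 → X2 → Y → ℝ} (hr : ∀ a b y, 0 < p1 a * p2 b * W a b y → 0 < r a b y) {c : ℝ}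
    (hc : c < ∑ a, ∑ b, ∑ y, p1 a * p2 b * W a b y * Real.logb 2 (r a b y)) :
    ∃ ρ : ℝ, 0 ≤ ρ ∧ ρ < 1 ∧ ∀ (n1 n2 k : ℕ) [NeZero n1] [NeZero n2] (m1 : ZMod n1)
      (m2 : ZMod n2), k ≤ n1 → k ≤ n2 →
      jointAvg W p1 p2 (winPos k m1) (winPos k m2)
        (fun x1 x2 y => boolReal (¬(2 : ℝ) ^ (c * k) ≤ windowScore r m1 m2 x1 x2 y)) ≤ ρ ^ k := by
  obtain ⟨l, hl, hlt⟩ := exists_exp_tilt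
    (fun z : X1 × X2 × Y => p1 z.1 * p2 z.2.1 * W z.1 z.2.1 z.2.2)
    (fun z => Real.logb 2 (r z.1 z.2.1 z.2.2)) (c := c)
    (by simp only [Fintype.sum_prod_type, ← Finset.mul_sum, hW1, mul_one, hp11, hp21])
    (by simpa only [Fintype.sum_prod_type] using hc)
  simp only [Fintype.sum_prod_type] at hlt
  refine ⟨_, ?_, hlt, fun n1 n2 k _ _ m1 m2 hk1 hk2 =>
    jointAvg_correct_le hW0 hW1 hp10 hp11 hp20 hp21 hk1 hk2 hr hl m1 m2⟩
  exact Finset.sum_nonneg fun a _ => Finset.sum_nonneg fun b _ => Finset.sum_nonneg fun y _ =>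
    mul_nonneg (mul_nonneg (mul_nonneg (hp10 a) (hp20 b)) (hW0 a b y)) (Real.exp_pos _).le

end Decoding

lemma exists_le_of_codeAvg_le {ι1 ι2 X1 X2 : Type*} [Fintype ι1] [Fintype ι2] [DecidableEq ι1]
    [DecidableEq ι2] [Fintype X1] [Fintype X2] [Nonempty X1] [Nonempty X2] {p1 : X1 → ℝ}
    {p2 : X2 → ℝ} (hp10 : ∀ a, 0 ≤ p1 a) (hp11 : ∑ a, p1 a = 1)
    (hp20 : ∀ b, 0 ≤ p2 b) (hp21 : ∑ b, p2 b = 1) (F : (ι1 → X1) → (ι2 → X2) → ℝ) {ε : ℝ}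
    (h : codeAvg p1 p2 F ≤ ε) : ∃ x1 x2, F x1 x2 ≤ ε := by
  obtain ⟨z, hz⟩ := Finite.exists_min fun z : (ι1 → X1) × (ι2 → X2) => F z.1 z.2
  refine ⟨z.1, z.2, le_trans ?_ h⟩
  rw [← codeAvg_const (ι1 := ι1) (ι2 := ι2) hp11 hp21 (F z.1 z.2)]
  exact codeAvg_mono hp10 hp20 fun x1 x2 => hz (x1, x2)

lemma mul_div_mul_le {p w D : ℝ} (hw : 0 ≤ w) : D * (p * w / (p * D)) ≤ w := by
  rcases eq_or_ne p 0 with rfl | hp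
  · simpa using hw
  rcases eq_or_ne D 0 with rfl | hD
  · simpa using hw
  · exact le_of_eq (by field_simp)

section Scores

variable {X1 X2 Y : Type*} [Fintype X1] [Fintype X2] [Fintype Y]
  {W : X1 → X2 → Y → ℝ} {p1 : X1 → ℝ} {p2 : X2 → ℝ}

lemma sum_score_fst_le (hW0 : ∀ a b y, 0 ≤ W a b y) (hW1 : ∀ a b, ∑ y, W a b y = 1)
    (hp20 : ∀ b, 0 ≤ p2 b) (hp21 : ∑ b, p2 b = 1) (a' : X1) :
    ∑ a, ∑ b, p1 a * p2 b * ∑ y, W a b y *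
      ((p1 a' * p2 b * W a' b y) / (p1 a' * ∑ a'', p1 a'' * p2 b * W a'' b y)) ≤ 1 := by
  calc _ = ∑ b, ∑ y, (∑ a, p1 a * p2 b * W a b y) *
        (p1 a' * (p2 b * W a' b y) / (p1 a' * ∑ a'', p1 a'' * p2 b * W a'' b y)) := by
        rw [Finset.sum_comm]
        refine Finset.sum_congr rfl fun b _ => ?_
        simp only [Finset.mul_sum (s := (Finset.univ : Finset Y))]
        rw [Finset.sum_comm]
        refine Finset.sum_congr rfl fun y _ => ?_
        rw [Finset.sum_mul]
        refine Finset.sum_congr rfl fun a _ => ?_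
        rw [mul_assoc (p1 a') (p2 b), mul_assoc (p1 a * p2 b)]
    _ ≤ ∑ b, ∑ y, p2 b * W a' b y := Finset.sum_le_sum fun b _ => Finset.sum_le_sum fun y _ =>
        mul_div_mul_le (mul_nonneg (hp20 b) (hW0 _ _ _))
    _ = 1 := by simp only [← Finset.mul_sum, hW1, mul_one, hp21]

lemma sum_score_snd_le (hW0 : ∀ a b y, 0 ≤ W a b y) (hW1 : ∀ a b, ∑ y, W a b y = 1)
    (hp10 : ∀ a, 0 ≤ p1 a) (hp11 : ∑ a, p1 a = 1) (b' : X2) :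
    ∑ a, ∑ b, p1 a * p2 b * ∑ y, W a b y *
      ((p1 a * p2 b' * W a b' y) / (p2 b' * ∑ b'', p1 a * p2 b'' * W a b'' y)) ≤ 1 := by
  calc _ = ∑ a, ∑ y, (∑ b, p1 a * p2 b * W a b y) *
        (p2 b' * (p1 a * W a b' y) / (p2 b' * ∑ b'', p1 a * p2 b'' * W a b'' y)) := by
        refine Finset.sum_congr rfl fun a _ => ?_
        simp only [Finset.mul_sum (s := (Finset.univ : Finset Y))]
        rw [Finset.sum_comm]
        refine Finset.sum_congr rfl fun y _ => ?_
        rw [Finset.sum_mul]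
        refine Finset.sum_congr rfl fun b _ => ?_
        rw [mul_comm (p1 a) (p2 b'), mul_assoc (p2 b') (p1 a), mul_assoc (p1 a * p2 b)]
    _ ≤ ∑ a, ∑ y, p1 a * W a b' y := Finset.sum_le_sum fun a _ => Finset.sum_le_sum fun y _ =>
        mul_div_mul_le (mul_nonneg (hp10 a) (hW0 _ _ _))
    _ = 1 := by simp only [← Finset.mul_sum, hW1, mul_one, hp11]

lemma sum_score_pair_le (hW0 : ∀ a b y, 0 ≤ W a b y) (hW1 : ∀ a b, ∑ y, W a b y = 1)
    (a' : X1) (b' : X2) :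
    ∑ a, ∑ b, p1 a * p2 b * ∑ y, W a b y *
      ((p1 a' * p2 b' * W a' b' y) /
        (p1 a' * p2 b' * ∑ a'', ∑ b'', p1 a'' * p2 b'' * W a'' b'' y)) ≤ 1 := by
  calc _ = ∑ y, (∑ a, ∑ b, p1 a * p2 b * W a b y) * ((p1 a' * p2 b' * W a' b' y) /
        (p1 a' * p2 b' * ∑ a'', ∑ b'', p1 a'' * p2 b'' * W a'' b'' y)) := by
        simp only [Finset.sum_mul (s := (Finset.univ : Finset X1)),
          Finset.sum_mul (s := (Finset.univ : Finset X2)),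
          Finset.mul_sum (s := (Finset.univ : Finset Y))]
        conv_rhs => rw [Finset.sum_comm]
        refine Finset.sum_congr rfl fun a _ => ?_
        rw [Finset.sum_comm]
        refine Finset.sum_congr rfl fun y _ => Finset.sum_congr rfl fun b _ => ?_
        rw [mul_assoc (p1 a * p2 b)]
    _ ≤ ∑ y, W a' b' y := Finset.sum_le_sum fun y _ => mul_div_mul_le (hW0 _ _ _)
    _ = 1 := hW1 _ _

end Scores

/-- If the code average of the confusion probability of every phase pair is at most `ε`, then some
code and detector have average error probability at most `ε`. -/
lemma exists_code_of_confused_le {X1 X2 Y : Type*} [Fintype X1] [Fintype X2] [Fintype Y]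
    [Nonempty X1] [Nonempty X2] {W : X1 → X2 → Y → ℝ} {p1 : X1 → ℝ} {p2 : X2 → ℝ}
    (hW0 : ∀ a b y, 0 ≤ W a b y) (hp10 : ∀ a, 0 ≤ p1 a) (hp11 : ∑ a, p1 a = 1)
    (hp20 : ∀ b, 0 ≤ p2 b) (hp21 : ∑ b, p2 b = 1) {n1 n2 k : ℕ} [NeZero n1] [NeZero n2]
    (r1 r2 r12 : X1 → X2 → Y → ℝ) (T1 T2 T12 : ℝ) {ε : ℝ}
    (h : ∀ (m1 : ZMod n1) (m2 : ZMod n2), jointAvg W p1 p2 (winPos k m1) (winPos k m2)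
      (fun x1 x2 y => boolReal (Confused r1 r2 r12 T1 T2 T12 x1 x2 y (m1, m2))) ≤ ε) :
    ∃ (x1 : ZMod n1 → X1) (x2 : ZMod n2 → X2) (g : (Fin k → Y) → ZMod n1 × ZMod n2),
      (1 / ((n1 : ℝ) * (n2 : ℝ))) * ∑ m1 : ZMod n1, ∑ m2 : ZMod n2,
        ∑ y ∈ Finset.univ.filter (fun y : Fin k → Y => g y ≠ (m1, m2)),
          ∏ i : Fin k, W (win k x1 m1 i) (win k x2 m2 i) (y i) ≤ ε := by
  have hn1 : (0 : ℝ) < n1 := Nat.cast_pos.mpr (NeZero.pos n1)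
  have hn2 : (0 : ℝ) < n2 := Nat.cast_pos.mpr (NeZero.pos n2)
  have havg : codeAvg p1 p2 (fun (x1 : ZMod n1 → X1) (x2 : ZMod n2 → X2) =>
      (∑ m1 : ZMod n1, ∑ m2 : ZMod n2, ∑ y : Fin k → Y,
        (∏ i, W (x1 (winPos k m1 i)) (x2 (winPos k m2 i)) (y i)) *
          boolReal (Confused r1 r2 r12 T1 T2 T12 x1 x2 y (m1, m2))) *
        (1 / ((n1 : ℝ) * (n2 : ℝ)))) ≤ ε := by
    rw [codeAvg_mul_const, codeAvg_sum, mul_one_div, div_le_iff₀ (mul_pos hn1 hn2)]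
    calc _ ≤ ∑ _m1 : ZMod n1, ∑ _m2 : ZMod n2, ε := Finset.sum_le_sum fun m1 _ => by
          rw [codeAvg_sum]
          exact Finset.sum_le_sum fun m2 _ => h m1 m2
      _ = ε * (n1 * n2) := by
          simp only [Finset.sum_const, Finset.card_univ, ZMod.card, nsmul_eq_mul]
          ring
  obtain ⟨x1, x2, hx⟩ := exists_le_of_codeAvg_le hp10 hp11 hp20 hp21 _ havg
  obtain ⟨g, hg⟩ := exists_detector (k := k) r1 r2 r12 T1 T2 T12 x1 x2
  refine ⟨x1, x2, g, le_trans ?_ hx⟩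
  rw [mul_comm]
  refine mul_le_mul_of_nonneg_right ?_ (by positivity)
  refine Finset.sum_le_sum fun m1 _ => Finset.sum_le_sum fun m2 _ => ?_
  rw [Finset.sum_filter]
  refine Finset.sum_le_sum fun y _ => ?_
  have hprod : 0 ≤ ∏ i, W (x1 (winPos k m1 i)) (x2 (winPos k m2 i)) (y i) :=
    Finset.prod_nonneg fun _ _ => hW0 _ _ _
  split_ifs with hne
  · rw [boolReal_pos (hg y (m1, m2) hne), mul_one]
    exact le_rfl
  · exact mul_nonneg hprod (boolReal_nonneg _)

/-- Achievability of phase detection with given scores: if the rates lie below the mean log-scores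
and wrong phases have conditional mean score at most `1`, the error can be made small. -/
lemma exists_phase_detector {X1 X2 Y : Type*} [Fintype X1] [Fintype X2] [Fintype Y]
    [Nonempty X1] [Nonempty X2] {W : X1 → X2 → Y → ℝ} {p1 : X1 → ℝ} {p2 : X2 → ℝ}
    (hW0 : ∀ a b y, 0 ≤ W a b y) (hW1 : ∀ a b, ∑ y, W a b y = 1)
    (hp10 : ∀ a, 0 ≤ p1 a) (hp11 : ∑ a, p1 a = 1)
    (hp20 : ∀ b, 0 ≤ p2 b) (hp21 : ∑ b, p2 b = 1) {R1 R2 : ℝ} (hR1 : 0 < R1) (hR2 : 0 < R2)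
    {r1 r2 r12 : X1 → X2 → Y → ℝ} (hr1 : ∀ a b y, 0 ≤ r1 a b y) (hr2 : ∀ a b y, 0 ≤ r2 a b y)
    (hr12 : ∀ a b y, 0 ≤ r12 a b y)
    (hpos : ∀ a b y, 0 < p1 a * p2 b * W a b y → 0 < r1 a b y ∧ 0 < r2 a b y ∧ 0 < r12 a b y)
    (hsum1 : ∀ a', ∑ a, ∑ b, p1 a * p2 b * ∑ y, W a b y * r1 a' b y ≤ 1)
    (hsum2 : ∀ b', ∑ a, ∑ b, p1 a * p2 b * ∑ y, W a b y * r2 a b' y ≤ 1)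
    (hsum12 : ∀ a' b', ∑ a, ∑ b, p1 a * p2 b * ∑ y, W a b y * r12 a' b' y ≤ 1)
    (hI1 : R1 < ∑ a, ∑ b, ∑ y, p1 a * p2 b * W a b y * Real.logb 2 (r1 a b y))
    (hI2 : R2 < ∑ a, ∑ b, ∑ y, p1 a * p2 b * W a b y * Real.logb 2 (r2 a b y))
    (hI12 : R1 + R2 < ∑ a, ∑ b, ∑ y, p1 a * p2 b * W a b y * Real.logb 2 (r12 a b y))
    {ε : ℝ} (hε : 0 < ε) :
    ∃ K : ℕ, ∀ k : ℕ, K ≤ k →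
      ∃ (n1 n2 : ℕ) (_ : NeZero n1) (_ : NeZero n2),
        (2 : ℝ) ^ (R1 * k) ≤ n1 ∧ (2 : ℝ) ^ (R2 * k) ≤ n2 ∧
        ∃ (x1 : ZMod n1 → X1) (x2 : ZMod n2 → X2)
          (g : (Fin k → Y) → ZMod n1 × ZMod n2),
          (1 / ((n1 : ℝ) * (n2 : ℝ))) * ∑ m1 : ZMod n1, ∑ m2 : ZMod n2,
            ∑ y ∈ Finset.univ.filter (fun y : Fin k → Y => g y ≠ (m1, m2)),
              ∏ i : Fin k, W (win k x1 m1 i) (win k x2 m2 i) (y i) ≤ ε := by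
  obtain ⟨c1, hc1, hc1'⟩ := exists_between hI1
  obtain ⟨c2, hc2, hc2'⟩ := exists_between hI2
  obtain ⟨c, hc, hc'⟩ := exists_between hI12
  obtain ⟨ρ1, hρ10, hρ11, hρ1⟩ := exists_jointAvg_correct_le hW0 hW1 hp10 hp11 hp20 hp21
    (fun a b y h => (hpos a b y h).1) hc1'
  obtain ⟨ρ2, hρ20, hρ21, hρ2⟩ := exists_jointAvg_correct_le hW0 hW1 hp10 hp11 hp20 hp21
    (fun a b y h => (hpos a b y h).2.1) hc2'
  obtain ⟨ρ, hρ0, hρl, hρ⟩ := exists_jointAvg_correct_le hW0 hW1 hp10 hp11 hp20 hp21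
    (fun a b y h => (hpos a b y h).2.2) hc'
  have htend : ∀ {d : ℝ} (j : ℕ), 0 < d → Filter.Tendsto
      (fun k : ℕ => (k : ℝ) ^ j * ((2 : ℝ) ^ (-d)) ^ k) Filter.atTop (nhds 0) := by
    intro d j hd
    refine tendsto_pow_const_mul_const_pow_of_abs_lt_one j ?_
    rw [abs_of_pos (Real.rpow_pos_of_pos two_pos _)]
    exact Real.rpow_lt_one_of_one_lt_of_neg one_lt_two (neg_lt_zero.mpr hd)
  have hcpos : 0 < c / 4 := by linarith
  have hlim : Filter.Tendsto (fun k : ℕ => ρ1 ^ k + ρ2 ^ k + ρ ^ k +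
      2 * ((k : ℝ) ^ 0 * ((2 : ℝ) ^ (-(c1 - R1))) ^ k) +
      2 * ((k : ℝ) ^ 0 * ((2 : ℝ) ^ (-(c2 - R2))) ^ k) +
      (4 * ((k : ℝ) ^ 0 * ((2 : ℝ) ^ (-(c - (R1 + R2)))) ^ k) +
      16 * ((k : ℝ) ^ 2 * ((2 : ℝ) ^ (-(c / 4))) ^ k))) Filter.atTop (nhds 0) := by
    simpa using ((((tendsto_pow_atTop_nhds_zero_of_lt_one hρ10 hρ11).add
      (tendsto_pow_atTop_nhds_zero_of_lt_one hρ20 hρ21)).add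
      (tendsto_pow_atTop_nhds_zero_of_lt_one hρ0 hρl)).add
      ((htend 0 (sub_pos.mpr hc1)).const_mul 2)).add
      ((htend 0 (sub_pos.mpr hc2)).const_mul 2) |>.add
      (((htend 0 (sub_pos.mpr hc)).const_mul 4).add ((htend 2 hcpos).const_mul 16))
  have hsmall := hlim.eventually (ge_mem_nhds hε)
  have hlong : ∀ {R : ℝ}, 0 < R → ∀ᶠ k : ℕ in Filter.atTop, 2 * (k : ℝ) ≤ (2 : ℝ) ^ (R * k) := by
    intro R hR
    filter_upwards [(htend 1 hR).eventually (ge_mem_nhds (show (0 : ℝ) < 1 / 2 by norm_num))]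
      with k hk
    rw [pow_one, ← Real.rpow_mul_natCast two_pos.le, neg_mul, Real.rpow_neg two_pos.le,
      ← div_eq_mul_inv, div_le_iff₀ (Real.rpow_pos_of_pos two_pos _)] at hk
    linarith
  obtain ⟨K, hK⟩ := Filter.eventually_atTop.mp (hsmall.and ((hlong hR1).and (hlong hR2)))
  refine ⟨K, fun k hk => ?_⟩
  obtain ⟨hε', hk1, hk2⟩ := hK k hk
  have hone : ∀ {R : ℝ}, 0 < R → (1 : ℝ) ≤ (2 : ℝ) ^ (R * k) := fun hR =>
    Real.one_le_rpow one_le_two (by positivity)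
  have hceil : ∀ {R : ℝ}, 0 < R → (⌈(2 : ℝ) ^ (R * k)⌉₊ : ℝ) ≤ 2 * (2 : ℝ) ^ (R * k) := by
    intro R hR
    have h1 := hone hR
    have h2 := Nat.ceil_lt_add_one (zero_le_one.trans h1)
    linarith
  have hn1 := Nat.le_ceil ((2 : ℝ) ^ (R1 * k))
  have hn2 := Nat.le_ceil ((2 : ℝ) ^ (R2 * k))
  have hn1' := hceil hR1
  have hn2' := hceil hR2
  have hz1 : NeZero ⌈(2 : ℝ) ^ (R1 * k)⌉₊ :=
    ⟨(Nat.ceil_pos.mpr (zero_lt_one.trans_le (hone hR1))).ne'⟩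
  have hz2 : NeZero ⌈(2 : ℝ) ^ (R2 * k)⌉₊ :=
    ⟨(Nat.ceil_pos.mpr (zero_lt_one.trans_le (hone hR2))).ne'⟩
  refine ⟨⌈(2 : ℝ) ^ (R1 * k)⌉₊, ⌈(2 : ℝ) ^ (R2 * k)⌉₊, hz1, hz2, hn1, hn2, ?_⟩
  generalize ⌈(2 : ℝ) ^ (R1 * k)⌉₊ = n1 at *
  generalize ⌈(2 : ℝ) ^ (R2 * k)⌉₊ = n2 at *
  have hkn1 : 2 * k ≤ n1 := by exact_mod_cast hk1.trans hn1
  have hkn2 : 2 * k ≤ n2 := by exact_mod_cast hk2.trans hn2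
  have ht4 : ((2 : ℝ) ^ (c / 4 * k)) ^ 4 = (2 : ℝ) ^ (c * k) := by
    rw [← Real.rpow_mul_natCast two_pos.le]
    congr 1
    push_cast
    ring
  have hpow : ∀ d e : ℝ, (2 : ℝ) ^ (d * k) * ((2 : ℝ) ^ (e * k))⁻¹ = ((2 : ℝ) ^ (-(e - d))) ^ k := by
    intro d e
    rw [← Real.rpow_neg two_pos.le, ← Real.rpow_add two_pos, ← Real.rpow_mul_natCast two_pos.le]
    congr 1
    ring
  have hpair : ∀ (m1 : ZMod n1) (m2 : ZMod n2), jointAvg W p1 p2 (winPos k m1) (winPos k m2)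
      (fun x1 x2 y => boolReal (Confused r1 r2 r12 ((2 : ℝ) ^ (c1 * k)) ((2 : ℝ) ^ (c2 * k))
        (((2 : ℝ) ^ (c / 4 * k)) ^ 4) x1 x2 y (m1, m2))) ≤ ε := by
    intro m1 m2
    have h12 : jointAvg W p1 p2 (winPos k m1) (winPos k m2) (fun x1 x2 y =>
        boolReal (¬((2 : ℝ) ^ (c / 4 * k)) ^ 4 ≤ windowScore r12 m1 m2 x1 x2 y)) ≤ ρ ^ k := by
      rw [ht4]
      exact hρ n1 n2 k m1 m2 (by omega) (by omega)
    refine (jointAvg_confused_le hW0 hW1 hp10 hp11 hp20 hp21 hkn1 hkn2 hr1 hr2 hr12 hsum1 hsum2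
      hsum12 m1 m2 (Real.rpow_pos_of_pos two_pos _) (Real.rpow_pos_of_pos two_pos _)
      (Real.rpow_pos_of_pos two_pos _) (hρ1 n1 n2 k m1 m2 (by omega) (by omega))
      (hρ2 n1 n2 k m1 m2 (by omega) (by omega))
      h12).trans (le_trans ?_ hε')
    rw [ht4]
    refine add_le_add (add_le_add (add_le_add le_rfl ?_) ?_) (add_le_add ?_ ?_)
    · rw [← hpow, pow_zero, one_mul, ← mul_assoc]
      gcongr
    · rw [← hpow, pow_zero, one_mul, ← mul_assoc]
      gcongr
    · rw [← hpow, pow_zero, one_mul, ← mul_assoc, add_mul, Real.rpow_add two_pos]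
      refine mul_le_mul_of_nonneg_right ?_ (by positivity)
      calc (n1 : ℝ) * n2 ≤ (2 * (2 : ℝ) ^ (R1 * k)) * (2 * (2 : ℝ) ^ (R2 * k)) := by gcongr
        _ = _ := by ring
    · rw [← Real.rpow_mul_natCast two_pos.le, neg_mul, Real.rpow_neg two_pos.le]
      exact le_of_eq (by ring)
  exact exists_code_of_confused_le hW0 hp10 hp11 hp20 hp21 _ _ _ _ _ _ hpair
theorem stmt10 {X1 X2 Y : Type*} [Fintype X1] [Fintype X2] [Fintype Y]
    [Nonempty X1] [Nonempty X2] [Nonempty Y] [DecidableEq Y]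
    (W : X1 → X2 → Y → ℝ) (hW0 : ∀ a b y, 0 ≤ W a b y)
    (hW1 : ∀ a b, ∑ y : Y, W a b y = 1)
    (p1 : X1 → ℝ) (hp10 : ∀ a, 0 ≤ p1 a) (hp11 : ∑ a : X1, p1 a = 1)
    (p2 : X2 → ℝ) (hp20 : ∀ b, 0 ≤ p2 b) (hp21 : ∑ b : X2, p2 b = 1)
    (R1 R2 : ℝ) (hR1 : 0 < R1) (hR2 : 0 < R2)
    (hI1 : R1 < ∑ a : X1, ∑ b : X2, ∑ y : Y,
      p1 a * p2 b * W a b y *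
        Real.logb 2 ((p1 a * p2 b * W a b y) /
          (p1 a * ∑ a' : X1, p1 a' * p2 b * W a' b y)))
    (hI2 : R2 < ∑ a : X1, ∑ b : X2, ∑ y : Y,
      p1 a * p2 b * W a b y *
        Real.logb 2 ((p1 a * p2 b * W a b y) /
          (p2 b * ∑ b' : X2, p1 a * p2 b' * W a b' y)))
    (hI12 : R1 + R2 < ∑ a : X1, ∑ b : X2, ∑ y : Y,
      p1 a * p2 b * W a b y *
        Real.logb 2 ((p1 a * p2 b * W a b y) /
          (p1 a * p2 b * ∑ a' : X1, ∑ b' : X2, p1 a' * p2 b' * W a' b' y)))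
    (ε : ℝ) (hε : 0 < ε) :
    ∃ K : ℕ, ∀ k : ℕ, K ≤ k →
      ∃ (n1 n2 : ℕ) (_ : NeZero n1) (_ : NeZero n2),
        (2 : ℝ) ^ (R1 * k) ≤ n1 ∧ (2 : ℝ) ^ (R2 * k) ≤ n2 ∧
        ∃ (x1 : ZMod n1 → X1) (x2 : ZMod n2 → X2)
          (g : (Fin k → Y) → ZMod n1 × ZMod n2),
          (1 / ((n1 : ℝ) * (n2 : ℝ))) * ∑ m1 : ZMod n1, ∑ m2 : ZMod n2,
            ∑ y ∈ Finset.univ.filter (fun y : Fin k → Y => g y ≠ (m1, m2)),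
              ∏ i : Fin k, W (win k x1 m1 i) (win k x2 m2 i) (y i) ≤ ε := by
  have hq0 : ∀ a b y, 0 ≤ p1 a * p2 b * W a b y := fun a b y =>
    mul_nonneg (mul_nonneg (hp10 a) (hp20 b)) (hW0 a b y)
  have hD1 : ∀ b y, 0 ≤ ∑ a, p1 a * p2 b * W a b y := fun b y =>
    Finset.sum_nonneg fun a _ => hq0 a b y
  have hD2 : ∀ a y, 0 ≤ ∑ b, p1 a * p2 b * W a b y := fun a y =>
    Finset.sum_nonneg fun b _ => hq0 a b y
  have hD12 : ∀ y, 0 ≤ ∑ a, ∑ b, p1 a * p2 b * W a b y := fun y =>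
    Finset.sum_nonneg fun a _ => hD2 a y
  refine exists_phase_detector hW0 hW1 hp10 hp11 hp20 hp21 hR1 hR2
    (fun a b y => div_nonneg (hq0 a b y) (mul_nonneg (hp10 a) (hD1 b y)))
    (fun a b y => div_nonneg (hq0 a b y) (mul_nonneg (hp20 b) (hD2 a y)))
    (fun a b y => div_nonneg (hq0 a b y)
      (mul_nonneg (mul_nonneg (hp10 a) (hp20 b)) (hD12 y)))
    ?_ (sum_score_fst_le hW0 hW1 hp20 hp21) (sum_score_snd_le hW0 hW1 hp10 hp11)
    (sum_score_pair_le hW0 hW1) hI1 hI2 hI12 hε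
  intro a b y hq
  have hp1 : 0 < p1 a := lt_of_le_of_ne (hp10 a) fun h => by simp [← h] at hq
  have hp2 : 0 < p2 b := lt_of_le_of_ne (hp20 b) fun h => by simp [← h] at hq
  have h1 := hq.trans_le (Finset.single_le_sum (f := fun a => p1 a * p2 b * W a b y)
    (fun a _ => hq0 a b y) (Finset.mem_univ a))
  have h2 := hq.trans_le (Finset.single_le_sum (f := fun b => p1 a * p2 b * W a b y)
    (fun b _ => hq0 a b y) (Finset.mem_univ b))
  have h12 := h2.trans_le (Finset.single_le_sum (f := fun a => ∑ b, p1 a * p2 b * W a b y)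
    (fun a _ => hD2 a y) (Finset.mem_univ a))
  exact ⟨div_pos hq (mul_pos hp1 h1), div_pos hq (mul_pos hp2 h2),
    div_pos hq (mul_pos (mul_pos hp1 hp2) h12)⟩
end

section
/- Let 𝒳₁, 𝒳₂, 𝒴 be finite nonempty sets and W(y|x₁,x₂) a discrete memoryless multiple access channel. Consider any multiple access phase detection scheme given by sequences x₁ ∈ 𝒳₁^{n₁}, x₂ ∈ 𝒳₂^{n₂}, window length k, and detector g : 𝒴^k → {1,…,n₁}×{1,…,n₂}, whose average probability of error is P_e = (1/(n₁n₂))·Σ_{m₁,m₂} Σ_{y^k : g(y^k) ≠ (m₁,m₂)} ∏_{i=0}^{k−1} W(y_{1+i}|x_{1,m₁+i},x_{2,m₂+i}). Then there exist probability mass functions q₁ on 𝒳₁ and q₂ on 𝒳₂ such that, with P(x₁,x₂,y) = q₁(x₁)q₂(x₂)W(y|x₁,x₂) and with I(X₁;Y|X₂) = Σ P(x₁,x₂,y) log₂( P(x₁,x₂,y) / (q₁(x₁)·Σ_{x₁'}P(x₁',x₂,y)) ), I(X₂;Y|X₁) = Σ P(x₁,x₂,y) log₂( P(x₁,x₂,y)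 / (q₂(x₂)·Σ_{x₂'}P(x₁,x₂',y)) ), I(X₁,X₂;Y) = Σ P(x₁,x₂,y) log₂( P(x₁,x₂,y) / (q₁(x₁)q₂(x₂)·Σ_{x₁',x₂'}P(x₁',x₂',y)) ) (zero-probability terms contributing 0), the following hold with ε = P_e·log₂(n₁n₂)/k + 1/k: log₂(n₁)/k ≤ I(X₁;Y|X₂) + ε, log₂(n₂)/k ≤ I(X₂;Y|X₁) + ε, and log₂(n₁n₂)/k ≤ I(X₁,X₂;Y) + ε. -/
open Finset in
/-- A function of one coordinate, averaged against a product of probability vectors,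
is averaged against the corresponding factor. -/
lemma sum_pi_prod_mul {ι Y : Type*} [Fintype ι] [DecidableEq ι] [Fintype Y] (f : ι → Y → ℝ)
    (hf : ∀ i, ∑ y, f i y = 1) (i : ι) (L : Y → ℝ) :
    ∑ y : ι → Y, (∏ j, f j (y j)) * L (y i) = ∑ y, f i y * L y := by
  have h1 : ∀ y : ι → Y, (∏ j, f j (y j)) * L (y i)
      = ∏ j, (f j (y j) * if j = i then L (y j) else 1) := by
    intro y
    rw [prod_mul_distrib, prod_ite_eq' univ i fun j => L (y j), if_pos (mem_univ i)]
  have h2 : ∀ j, ∑ y, (f j y * if j = i then L y else 1)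
      = if j = i then ∑ y, f j y * L y else 1 := by
    intro j
    split_ifs with h
    · rfl
    · simp [hf]
  simp_rw [h1]
  rw [← Fintype.prod_sum fun j y => f j y * if j = i then L y else 1]
  simp_rw [h2]
  rw [prod_ite_eq' univ i fun j => ∑ y, f j y * L y, if_pos (mem_univ i)]

lemma sum_pi_prod_eq_one {ι Y : Type*} [Fintype ι] [DecidableEq ι] [Fintype Y] (f : ι → Y → ℝ)
    (hf : ∀ i, ∑ y, f i y = 1) : ∑ y : ι → Y, ∏ j, f j (y j) = 1 := by
  rw [← Fintype.prod_sum]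
  simp [hf]

/-- The relative entropy of two product probability vectors is the sum of the relative
entropies of the factors. -/
lemma sum_pi_prod_mul_log_div {ι Y : Type*} [Fintype ι] [DecidableEq ι] [Fintype Y]
    (f v : ι → Y → ℝ) (hf : ∀ i, ∑ y, f i y = 1) (hfv : ∀ i y, f i y ≠ 0 → v i y ≠ 0) :
    ∑ y : ι → Y, (∏ j, f j (y j)) * Real.log ((∏ j, f j (y j)) / ∏ j, v j (y j))
      = ∑ i, ∑ y, f i y * Real.log (f i y / v i y) := by
  have h1 : ∀ y : ι → Y,
      (∏ j, f j (y j)) * Real.log ((∏ j, f j (y j)) / ∏ j, v j (y j))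
        = ∑ i, (∏ j, f j (y j)) * Real.log (f i (y i) / v i (y i)) := by
    intro y
    by_cases h : ∏ j, f j (y j) = 0
    · simp [h]
    · have hne : ∀ j, f j (y j) ≠ 0 := fun j => Finset.prod_ne_zero_iff.1 h j (Finset.mem_univ j)
      rw [← Finset.prod_div_distrib, Real.log_prod, Finset.mul_sum]
      exact fun j _ => div_ne_zero (hne j) (hfv _ _ (hne j))
  simp_rw [h1]
  rw [Finset.sum_comm]
  exact Finset.sum_congr rfl fun i _ => sum_pi_prod_mul f hf i fun y => Real.log (f i y / v i y)

lemma sub_mul_le_mul_log_div {p r c : ℝ} (hp : 0 ≤ p) (hr : 0 ≤ r) (hc : 0 < c)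
    (hpr : p ≠ 0 → r ≠ 0) : p - c * r ≤ p * Real.log (p / r) - p * Real.log c := by
  rcases hp.eq_or_lt with rfl | hp'
  · simp only [zero_sub, zero_mul, sub_zero]
    linarith [mul_nonneg hc.le hr]
  · have hr' : 0 < r := lt_of_le_of_ne hr (hpr hp'.ne').symm
    have h := Real.log_le_sub_one_of_pos (show 0 < c * r / p by positivity)
    rw [Real.log_div (by positivity) hp'.ne', Real.log_mul hc.ne' hr'.ne'] at h
    rw [Real.log_div hp'.ne' hr'.ne']
    have h2 := mul_le_mul_of_nonneg_left h hp
    have h3 : p * (c * r / p - 1) = c * r - p := by field_simp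
    linarith

/-- Converse bound for a detector `g` of a uniformly distributed message `m`, observed through
the product channel `∏ i, U m i`, by comparison with an auxiliary product channel `∏ i, V m i`
under which `g` succeeds with probability at most `1 / n`. -/
lemma card_sub_error_mul_log_le {M ι Y : Type*} [Fintype M] [DecidableEq M] [Fintype ι]
    [DecidableEq ι] [Fintype Y] (U V : M → ι → Y → ℝ)
    (hU0 : ∀ m i y, 0 ≤ U m i y) (hV0 : ∀ m i y, 0 ≤ V m i y)
    (hU1 : ∀ m i, ∑ y, U m i y = 1) (hV1 : ∀ m i, ∑ y, V m i y = 1)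
    (hUV : ∀ m i y, U m i y ≠ 0 → V m i y ≠ 0)
    (g : (ι → Y) → M) {n : ℝ} (hn : 0 < n)
    (hg : n * ∑ m, ∑ y : ι → Y, (if g y = m then ∏ i, V m i (y i) else 0) ≤ Fintype.card M) :
    (Fintype.card M - ∑ m, ∑ y with g y ≠ m, ∏ i, U m i (y i)) * Real.log n
        - Fintype.card M * Real.log 2
      ≤ ∑ m, ∑ i, ∑ y, U m i y * Real.log (U m i y / V m i y) := by
  set P : M → (ι → Y) → ℝ := fun m y => ∏ i, U m i (y i) with hP
  set R : M → (ι → Y) → ℝ := fun m y => ∏ i, V m i (y i) with hR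
  have hP0 : ∀ m y, 0 ≤ P m y := fun m y => Finset.prod_nonneg fun i _ => hU0 _ _ _
  have hR0 : ∀ m y, 0 ≤ R m y := fun m y => Finset.prod_nonneg fun i _ => hV0 _ _ _
  have hP1 : ∑ m, ∑ y, P m y = Fintype.card M := by
    simp [hP, fun m => sum_pi_prod_eq_one (U m) (hU1 m)]
  have hR1 : ∑ m, ∑ y, R m y = Fintype.card M := by
    simp [hR, fun m => sum_pi_prod_eq_one (V m) (hV1 m)]
  have hPR : ∀ m y, P m y ≠ 0 → R m y ≠ 0 := fun m y h => Finset.prod_ne_zero_iff.2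
    fun i hi => hUV _ _ _ (Finset.prod_ne_zero_iff.1 h i hi)
  have hsplit : ∑ m, ∑ y with g y ≠ m, P m y
      = Fintype.card M - ∑ m, ∑ y, (if g y = m then P m y else 0) := by
    rw [← hP1, ← Finset.sum_sub_distrib]
    refine Finset.sum_congr rfl fun m _ => ?_
    rw [← Finset.sum_sub_distrib, Finset.sum_filter]
    refine Finset.sum_congr rfl fun y _ => ?_
    by_cases h : g y = m <;> simp [h]
  have hterm : ∀ m y, P m y - (1 / 2 * R m y + n / 2 * (if g y = m then R m y else 0))
      ≤ P m y * Real.log (P m y / R m y)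
        - (Real.log n * (if g y = m then P m y else 0) - Real.log 2 * P m y) := by
    intro m y
    by_cases h : g y = m
    · have := sub_mul_le_mul_log_div (hP0 m y) (hR0 m y) (half_pos hn) (hPR m y)
      rw [Real.log_div hn.ne' two_ne_zero] at this
      simp only [h, if_true]
      linarith [hR0 m y]
    · have := sub_mul_le_mul_log_div (hP0 m y) (hR0 m y) (c := 1 / 2) (by norm_num) (hPR m y)
      rw [one_div, Real.log_inv] at this
      simp only [h, if_false]
      linarith
  have hsum := Finset.sum_le_sum fun m (_ : m ∈ Finset.univ) =>
    Finset.sum_le_sum fun y (_ : y ∈ Finset.univ) => hterm m y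
  simp only [Finset.sum_sub_distrib, Finset.sum_add_distrib, ← Finset.mul_sum] at hsum
  rw [hP1, hR1] at hsum
  have hlog : ∑ m, ∑ y, P m y * Real.log (P m y / R m y)
      = ∑ m, ∑ i, ∑ y, U m i y * Real.log (U m i y / V m i y) :=
    Finset.sum_congr rfl fun m _ => sum_pi_prod_mul_log_div (U m) (V m) (hU1 m) (hUV m)
  rw [hlog] at hsum
  rw [hsplit]
  linarith

open Classical in
/-- The empirical distribution of the entries of a finite family. -/
noncomputable def empirical {ι α : Type*} [Fintype ι] (x : ι → α) (a : α) : ℝ :=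
  (∑ m, if x m = a then (1 : ℝ) else 0) / Fintype.card ι

lemma empirical_nonneg {ι α : Type*} [Fintype ι] (x : ι → α) (a : α) : 0 ≤ empirical x a := by
  unfold empirical
  positivity

lemma sum_empirical_mul {ι α : Type*} [Fintype ι] [Fintype α] (x : ι → α) (F : α → ℝ) :
    ∑ a, empirical x a * F a = (∑ m, F (x m)) / Fintype.card ι := by
  classical
  simp only [empirical, div_mul_eq_mul_div, Finset.sum_mul]
  rw [← Finset.sum_div, Finset.sum_comm]
  congr 1
  refine Finset.sum_congr rfl fun m _ => ?_
  simp

lemma sum_empirical {ι α : Type*} [Fintype ι] [Nonempty ι] [Fintype α] (x : ι → α) :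
    ∑ a, empirical x a = 1 := by
  simpa using sum_empirical_mul x fun _ => (1 : ℝ)

lemma empirical_apply_pos {ι α : Type*} [Fintype ι] (x : ι → α) (m : ι) :
    0 < empirical x (x m) := by
  have : Nonempty ι := ⟨m⟩
  refine div_pos (Finset.sum_pos' (fun _ _ => by positivity) ⟨m, Finset.mem_univ m, ?_⟩) ?_
  · simp
  · exact_mod_cast Fintype.card_pos

/-- Summing a function of the `i`-th window letters over all phase pairs gives the same value for
every `i`, namely an average with respect to the product of the empirical distributions. -/
lemma sum_win_eq {X1 X2 : Type*} [Fintype X1] [Fintype X2] {n1 n2 : ℕ} [NeZero n1] [NeZero n2]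
    (k : ℕ) (x1 : ZMod n1 → X1) (x2 : ZMod n2 → X2) (F : X1 → X2 → ℝ) (i : Fin k) :
    ∑ m1, ∑ m2, F (win k x1 m1 i) (win k x2 m2 i)
      = n1 * n2 * ∑ a, ∑ b, empirical x1 a * empirical x2 b * F a b := by
  have h1 : (n1 : ℝ) ≠ 0 := Nat.cast_ne_zero.2 (NeZero.ne n1)
  have h2 : (n2 : ℝ) ≠ 0 := Nat.cast_ne_zero.2 (NeZero.ne n2)
  simp_rw [mul_assoc, ← Finset.mul_sum, sum_empirical_mul, ZMod.card, ← Finset.sum_div]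
  have e1 : ∑ m1, ∑ m2, F (win k x1 m1 i) (win k x2 m2 i) = ∑ m1, ∑ m2, F (x1 m1) (x2 m2) := by
    simp only [win]
    refine (Equiv.sum_comp (Equiv.addRight ((i : ℕ) : ZMod n1))
      fun m1 => ∑ m2, F (x1 m1) (x2 (m2 + ((i : ℕ) : ZMod n2)))).trans ?_
    exact Finset.sum_congr rfl fun m1 _ =>
      Equiv.sum_comp (Equiv.addRight ((i : ℕ) : ZMod n2)) fun m2 => F (x1 m1) (x2 m2)
  rw [e1]
  field_simp

/-- Converse bound for multiple access phase detection, by comparison with an auxiliary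
channel `V` under which the detector succeeds with probability at most `1 / n`. -/
lemma one_sub_error_mul_logb_le {X1 X2 Y : Type*} [Fintype X1] [Fintype X2] [Fintype Y]
    (W : X1 → X2 → Y → ℝ) (hW0 : ∀ a b y, 0 ≤ W a b y) (hW1 : ∀ a b, ∑ y : Y, W a b y = 1)
    (n1 n2 k : ℕ) [NeZero n1] [NeZero n2] (x1 : ZMod n1 → X1) (x2 : ZMod n2 → X2)
    (g : (Fin k → Y) → ZMod n1 × ZMod n2) (V : X1 → X2 → Y → ℝ)
    (hV0 : ∀ a b y, 0 ≤ V a b y) (hV1 : ∀ a b, ∑ y : Y, V a b y = 1)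
    (hWV : ∀ m1 m2 y, W (x1 m1) (x2 m2) y ≠ 0 → V (x1 m1) (x2 m2) y ≠ 0)
    {n : ℝ} (hn : 0 < n)
    (hg : n * ∑ m1, ∑ m2, ∑ y : Fin k → Y,
      (if g y = (m1, m2) then ∏ i, V (win k x1 m1 i) (win k x2 m2 i) (y i) else 0) ≤ n1 * n2) :
    (1 - 1 / ((n1 : ℝ) * n2) * ∑ m1, ∑ m2, ∑ y with g y ≠ (m1, m2),
        ∏ i, W (win k x1 m1 i) (win k x2 m2 i) (y i)) * Real.logb 2 n - 1
      ≤ k * ∑ a, ∑ b, ∑ y, empirical x1 a * empirical x2 b * W a b y *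
        Real.logb 2 (W a b y / V a b y) := by
  have h1 : (0 : ℝ) < n1 := Nat.cast_pos.2 (NeZero.pos n1)
  have h2 : (0 : ℝ) < n2 := Nat.cast_pos.2 (NeZero.pos n2)
  have hl2 : 0 < Real.log 2 := Real.log_pos one_lt_two
  have hcard : (Fintype.card (ZMod n1 × ZMod n2) : ℝ) = n1 * n2 := by
    simp [ZMod.card]
  have key := card_sub_error_mul_log_le
    (fun m : ZMod n1 × ZMod n2 => fun i : Fin k => W (win k x1 m.1 i) (win k x2 m.2 i))
    (fun m i => V (win k x1 m.1 i) (win k x2 m.2 i))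
    (fun _ _ _ => hW0 _ _ _) (fun _ _ _ => hV0 _ _ _) (fun _ _ => hW1 _ _) (fun _ _ => hV1 _ _)
    (fun _ _ _ h => hWV _ _ _ h) g hn
    (by rw [hcard, Fintype.sum_prod_type]; exact hg)
  rw [hcard, Fintype.sum_prod_type, Finset.sum_comm (s := Finset.univ (α := ZMod n1 × ZMod n2))]
    at key
  simp_rw [Fintype.sum_prod_type] at key
  rw [Finset.sum_congr rfl fun i _ => sum_win_eq k x1 x2
    (fun a b => ∑ y, W a b y * Real.log (W a b y / V a b y)) i] at key
  simp only [Finset.sum_const, Finset.card_univ, Fintype.card_fin, nsmul_eq_mul] at key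
  simp only [Finset.mul_sum (s := Finset.univ (α := Y)), ← mul_assoc] at key
  simp only [Real.logb, ← mul_div_assoc, ← Finset.sum_div]
  rw [sub_le_iff_le_add, div_le_iff₀ hl2, add_mul, div_mul_cancel₀ _ hl2.ne', one_mul,
    ← sub_le_iff_le_add]
  refine le_of_mul_le_mul_left ?_ (mul_pos h1 h2)
  refine (le_of_eq ?_).trans (key.trans (le_of_eq ?_))
  · field_simp
  · ring

theorem stmt11 {X1 X2 Y : Type*} [Fintype X1] [Fintype X2] [Fintype Y]
    [Nonempty X1] [Nonempty X2] [Nonempty Y] [DecidableEq Y]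
    (W : X1 → X2 → Y → ℝ) (hW0 : ∀ a b y, 0 ≤ W a b y)
    (hW1 : ∀ a b, ∑ y : Y, W a b y = 1)
    (n1 n2 k : ℕ) [NeZero n1] [NeZero n2] (hk : 0 < k)
    (x1 : ZMod n1 → X1) (x2 : ZMod n2 → X2)
    (g : (Fin k → Y) → ZMod n1 × ZMod n2)
    (Pe : ℝ)
    (hPe : Pe = (1 / ((n1 : ℝ) * (n2 : ℝ))) * ∑ m1 : ZMod n1, ∑ m2 : ZMod n2,
      ∑ y ∈ Finset.univ.filter (fun y : Fin k → Y => g y ≠ (m1, m2)),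
        ∏ i : Fin k, W (win k x1 m1 i) (win k x2 m2 i) (y i)) :
    ∃ (q1 : X1 → ℝ) (q2 : X2 → ℝ),
      (∀ a, 0 ≤ q1 a) ∧ (∑ a : X1, q1 a = 1) ∧
      (∀ b, 0 ≤ q2 b) ∧ (∑ b : X2, q2 b = 1) ∧
      Real.logb 2 (n1 : ℝ) / (k : ℝ) ≤
        (∑ a : X1, ∑ b : X2, ∑ y : Y,
          q1 a * q2 b * W a b y *
            Real.logb 2 ((q1 a * q2 b * W a b y) /
              (q1 a * ∑ a' : X1, q1 a' * q2 b * W a' b y))) +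
        (Pe * Real.logb 2 ((n1 : ℝ) * (n2 : ℝ)) / (k : ℝ) + 1 / (k : ℝ)) ∧
      Real.logb 2 (n2 : ℝ) / (k : ℝ) ≤
        (∑ a : X1, ∑ b : X2, ∑ y : Y,
          q1 a * q2 b * W a b y *
            Real.logb 2 ((q1 a * q2 b * W a b y) /
              (q2 b * ∑ b' : X2, q1 a * q2 b' * W a b' y))) +
        (Pe * Real.logb 2 ((n1 : ℝ) * (n2 : ℝ)) / (k : ℝ) + 1 / (k : ℝ)) ∧
      Real.logb 2 ((n1 : ℝ) * (n2 : ℝ)) / (k : ℝ) ≤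
        (∑ a : X1, ∑ b : X2, ∑ y : Y,
          q1 a * q2 b * W a b y *
            Real.logb 2 ((q1 a * q2 b * W a b y) /
              (q1 a * q2 b * ∑ a' : X1, ∑ b' : X2, q1 a' * q2 b' * W a' b' y))) +
        (Pe * Real.logb 2 ((n1 : ℝ) * (n2 : ℝ)) / (k : ℝ) + 1 / (k : ℝ)) := by
  set q1 := empirical x1 with hq1
  set q2 := empirical x2 with hq2
  have h1 : (0 : ℝ) < n1 := Nat.cast_pos.2 (NeZero.pos n1)
  have h2 : (0 : ℝ) < n2 := Nat.cast_pos.2 (NeZero.pos n2)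
  have hk' : (0 : ℝ) < k := Nat.cast_pos.2 hk
  have hl1 : 0 ≤ Real.logb 2 (n1 : ℝ) :=
    Real.logb_nonneg one_lt_two (by exact_mod_cast NeZero.one_le)
  have hl2 : 0 ≤ Real.logb 2 (n2 : ℝ) :=
    Real.logb_nonneg one_lt_two (by exact_mod_cast NeZero.one_le)
  have hl : Real.logb 2 ((n1 : ℝ) * n2) = Real.logb 2 n1 + Real.logb 2 n2 :=
    Real.logb_mul h1.ne' h2.ne'
  have hPe0 : 0 ≤ Pe := by
    rw [hPe]
    exact mul_nonneg (by positivity) (Finset.sum_nonneg fun _ _ => Finset.sum_nonneg fun _ _ =>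
      Finset.sum_nonneg fun _ _ => Finset.prod_nonneg fun _ _ => hW0 _ _ _)
  have q1n : ∀ a, 0 ≤ q1 a := empirical_nonneg x1
  have q2n : ∀ b, 0 ≤ q2 b := empirical_nonneg x2
  have q1s : ∑ a, q1 a = 1 := sum_empirical x1
  have q2s : ∑ b, q2 b = 1 := sum_empirical x2
  have q1p : ∀ m, 0 < q1 (x1 m) := empirical_apply_pos x1
  have q2p : ∀ m, 0 < q2 (x2 m) := empirical_apply_pos x2
  set V1 : X1 → X2 → Y → ℝ := fun _ b y => ∑ a', q1 a' * W a' b y with hV1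
  set V2 : X1 → X2 → Y → ℝ := fun a _ y => ∑ b', q2 b' * W a b' y with hV2
  set V3 : X1 → X2 → Y → ℝ := fun _ _ y => ∑ a', ∑ b', q1 a' * q2 b' * W a' b' y with hV3
  have V1n : ∀ a b y, 0 ≤ V1 a b y := fun a b y =>
    Finset.sum_nonneg fun a' _ => mul_nonneg (q1n a') (hW0 _ _ _)
  have V2n : ∀ a b y, 0 ≤ V2 a b y := fun a b y =>
    Finset.sum_nonneg fun b' _ => mul_nonneg (q2n b') (hW0 _ _ _)
  have V3n : ∀ a b y, 0 ≤ V3 a b y := fun a b y => Finset.sum_nonneg fun a' _ =>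
    Finset.sum_nonneg fun b' _ => mul_nonneg (mul_nonneg (q1n a') (q2n b')) (hW0 _ _ _)
  have V1s : ∀ a b, ∑ y, V1 a b y = 1 := by
    intro a b
    simp only [hV1]
    rw [Finset.sum_comm]
    simp [← Finset.mul_sum, hW1, q1s]
  have V2s : ∀ a b, ∑ y, V2 a b y = 1 := by
    intro a b
    simp only [hV2]
    rw [Finset.sum_comm]
    simp [← Finset.mul_sum, hW1, q2s]
  have V3s : ∀ a b, ∑ y, V3 a b y = 1 := by
    intro a b
    simp only [hV3]
    rw [Finset.sum_comm]
    simp_rw [Finset.sum_comm (s := Finset.univ (α := Y)), ← Finset.mul_sum, hW1, mul_one,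
      ← Finset.mul_sum, q2s, mul_one, q1s]
  have V1W : ∀ m1 m2 y, W (x1 m1) (x2 m2) y ≠ 0 → V1 (x1 m1) (x2 m2) y ≠ 0 := by
    intro m1 m2 y h
    have hW : 0 < W (x1 m1) (x2 m2) y := lt_of_le_of_ne (hW0 _ _ _) h.symm
    simp only [hV1]
    refine (Finset.sum_pos' (fun a' _ => ?_)
      ⟨x1 m1, Finset.mem_univ _, mul_pos (q1p m1) hW⟩).ne'
    exact mul_nonneg (q1n a') (hW0 _ _ _)
  have V2W : ∀ m1 m2 y, W (x1 m1) (x2 m2) y ≠ 0 → V2 (x1 m1) (x2 m2) y ≠ 0 := by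
    intro m1 m2 y h
    have hW : 0 < W (x1 m1) (x2 m2) y := lt_of_le_of_ne (hW0 _ _ _) h.symm
    simp only [hV2]
    refine (Finset.sum_pos' (fun b' _ => ?_)
      ⟨x2 m2, Finset.mem_univ _, mul_pos (q2p m2) hW⟩).ne'
    exact mul_nonneg (q2n b') (hW0 _ _ _)
  have V3W : ∀ m1 m2 y, W (x1 m1) (x2 m2) y ≠ 0 → V3 (x1 m1) (x2 m2) y ≠ 0 := by
    intro m1 m2 y h
    have hW : 0 < W (x1 m1) (x2 m2) y := lt_of_le_of_ne (hW0 _ _ _) h.symm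
    have hn : ∀ a' b', 0 ≤ q1 a' * q2 b' * W a' b' y := fun a' b' =>
      mul_nonneg (mul_nonneg (q1n a') (q2n b')) (hW0 _ _ _)
    exact (Finset.sum_pos' (fun a' _ => Finset.sum_nonneg fun b' _ => hn a' b')
      ⟨x1 m1, Finset.mem_univ _, Finset.sum_pos' (fun b' _ => hn _ b')
        ⟨x2 m2, Finset.mem_univ _, mul_pos (mul_pos (q1p m1) (q2p m2)) hW⟩⟩).ne'
  have b1 := one_sub_error_mul_logb_le W hW0 hW1 n1 n2 k x1 x2 g V1 V1n V1s V1W h1 (by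
    refine mul_le_mul_of_nonneg_left ?_ h1.le
    rw [Finset.sum_comm]
    calc _ ≤ ∑ m2 : ZMod n2, (1 : ℝ) := Finset.sum_le_sum fun m2 _ => ?_
      _ = n2 := by simp [ZMod.card]
    rw [Finset.sum_comm, ← sum_pi_prod_eq_one (fun i : Fin k => V1 (x1 0) (win k x2 m2 i))
      fun i => V1s (x1 0) (win k x2 m2 i)]
    refine Finset.sum_le_sum fun y _ => ?_
    have hprod : 0 ≤ ∏ i : Fin k, V1 (x1 0) (win k x2 m2 i) (y i) :=
      Finset.prod_nonneg fun _ _ => V1n (x1 0) _ _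
    rw [Finset.sum_eq_single (g y).1]
    · split_ifs
      · exact le_rfl
      · exact hprod
    · intro m1 _ hm
      exact if_neg fun h => hm (by rw [h])
    · simp)
  have b2 := one_sub_error_mul_logb_le W hW0 hW1 n1 n2 k x1 x2 g V2 V2n V2s V2W h2 (by
    rw [mul_comm (n1 : ℝ)]
    refine mul_le_mul_of_nonneg_left ?_ h2.le
    calc _ ≤ ∑ m1 : ZMod n1, (1 : ℝ) := Finset.sum_le_sum fun m1 _ => ?_
      _ = n1 := by simp [ZMod.card]
    rw [Finset.sum_comm, ← sum_pi_prod_eq_one (fun i : Fin k => V2 (win k x1 m1 i) (x2 0))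
      fun i => V2s (win k x1 m1 i) (x2 0)]
    refine Finset.sum_le_sum fun y _ => ?_
    have hprod : 0 ≤ ∏ i : Fin k, V2 (win k x1 m1 i) (x2 0) (y i) :=
      Finset.prod_nonneg fun _ _ => V2n _ (x2 0) _
    rw [Finset.sum_eq_single (g y).2]
    · split_ifs
      · exact le_rfl
      · exact hprod
    · intro m2 _ hm
      exact if_neg fun h => hm (by rw [h])
    · simp)
  have b3 := one_sub_error_mul_logb_le W hW0 hW1 n1 n2 k x1 x2 g V3 V3n V3s V3W (mul_pos h1 h2) (by
    refine mul_le_of_le_one_right (mul_pos h1 h2).le ?_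
    rw [← Fintype.sum_prod_type' fun m1 m2 => ∑ y : Fin k → Y, if g y = (m1, m2) then
      ∏ i, V3 (win k x1 m1 i) (win k x2 m2 i) (y i) else 0, Finset.sum_comm,
      ← sum_pi_prod_eq_one (fun _ : Fin k => V3 (x1 0) (x2 0)) fun _ => V3s (x1 0) (x2 0)]
    refine Finset.sum_le_sum fun y _ => ?_
    simp [hV3])
  rw [← hPe, ← hq1, ← hq2] at b1 b2 b3
  have hfin : ∀ l I J : ℝ, (1 - Pe) * l - 1 ≤ k * I → l ≤ Real.logb 2 ((n1 : ℝ) * n2) → I = J →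
      l / k ≤ J + (Pe * Real.logb 2 ((n1 : ℝ) * n2) / k + 1 / k) := by
    rintro l I _ h hle rfl
    rw [← add_div, ← sub_le_iff_le_add, ← sub_div, div_le_iff₀ hk']
    linarith [mul_le_mul_of_nonneg_left hle hPe0]
  have hterm : ∀ a b y v w, (q1 a * q2 b ≠ 0 → w = q1 a * q2 b * v) →
      q1 a * q2 b * W a b y * Real.logb 2 (W a b y / v)
        = q1 a * q2 b * W a b y * Real.logb 2 (q1 a * q2 b * W a b y / w) := by
    intro a b y v w h
    by_cases h0 : q1 a * q2 b = 0
    · simp [h0]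
    · rw [h h0, mul_div_mul_left _ _ h0]
  refine ⟨q1, q2, q1n, q1s, q2n, q2s, hfin _ _ _ b1 (by linarith) ?_,
    hfin _ _ _ b2 (by linarith) ?_, hfin _ _ _ b3 le_rfl ?_⟩
  all_goals
    refine Finset.sum_congr rfl fun a _ => Finset.sum_congr rfl fun b _ =>
      Finset.sum_congr rfl fun y _ => hterm a b y _ _ fun _ => ?_
  · simp only [hV1, Finset.mul_sum]
    exact Finset.sum_congr rfl fun _ _ => by ring
  · simp only [hV2, Finset.mul_sum]
    exact Finset.sum_congr rfl fun _ _ => by ring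
  · rfl
end

section
/- For all reals a, b ∈ [0,1], the quantity f(a,b) = h(a(1−b) + (1−a)b + ab/2) − ab, where h is the base-2 binary entropy function, satisfies f(a,b) ≤ 1, and f(a,b) = 1 if and only if (a,b) = (0, 1/2) or (a,b) = (1/2, 0). (Here f(a,b) equals the mutual information I(X₁,X₂;Y) for the push-to-talk multiple access channel with independent inputs X₁ ~ Bernoulli(a) and X₂ ~ Bernoulli(b).) -/
/-- Base-2 binary entropy function (with the convention `0 · log₂ 0 = 0`). -/
noncomputable def binEnt (q : ℝ) : ℝ :=
  -q * Real.logb 2 q - (1 - q) * Real.logb 2 (1 - q)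

theorem binEnt_eq_binEntropy_div (q : ℝ) : binEnt q = Real.binEntropy q / Real.log 2 := by
  simp only [binEnt, Real.binEntropy, Real.logb, Real.log_inv]
  ring

theorem binEnt_le_one (q : ℝ) : binEnt q ≤ 1 := by
  rw [binEnt_eq_binEntropy_div, div_le_one (Real.log_pos one_lt_two)]
  exact Real.binEntropy_le_log_two

theorem binEnt_eq_one_iff (q : ℝ) : binEnt q = 1 ↔ q = 1 / 2 := by
  rw [binEnt_eq_binEntropy_div, div_eq_one_iff_eq (Real.log_pos one_lt_two).ne',
    Real.binEntropy_eq_log_two, one_div]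

theorem stmt12 (a b : ℝ) (ha : a ∈ Set.Icc (0 : ℝ) 1) (hb : b ∈ Set.Icc (0 : ℝ) 1) :
    binEnt (a * (1 - b) + (1 - a) * b + a * b / 2) - a * b ≤ 1 ∧
    (binEnt (a * (1 - b) + (1 - a) * b + a * b / 2) - a * b = 1 ↔
      (a = 0 ∧ b = 1 / 2) ∨ (a = 1 / 2 ∧ b = 0)) := by
  have hab : 0 ≤ a * b := mul_nonneg ha.1 hb.1
  have hle := binEnt_le_one (a * (1 - b) + (1 - a) * b + a * b / 2)
  refine ⟨by linarith, fun h => ?_, ?_⟩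
  · have hzero : a * b = 0 := by linarith
    have hq := (binEnt_eq_one_iff _).1 (by linarith)
    rcases mul_eq_zero.1 hzero with rfl | rfl
    · exact Or.inl ⟨rfl, by linarith⟩
    · exact Or.inr ⟨by linarith, rfl⟩
  · rintro (⟨rfl, rfl⟩ | ⟨rfl, rfl⟩) <;> simp [(binEnt_eq_one_iff 2⁻¹).2 (one_div 2).symm]
end

section
/- For all reals R₁, R₂ > 0 with R₁ + R₂ < 1, there exists an integer K such that for every integer k ≥ K there exist integers n₁ ≥ 2^{R₁k} and n₂ ≥ 2^{R₂k} and binary sequences x₁ ∈ {0,1}^{n₁}, x₂ ∈ {0,1}^{n₂}, such that the map (m₁,m₂) ↦ φ₁(m₁) ⊕ φ₂(m₂) — the coordinatewise modulo-2 sum of the length-k cyclic window of x₁ at phase m₁ and the length-k cyclic window of x₂ at phase m₂ — is injective on {1,…,n₁} × {1,…,n₂}. -/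
open Polynomial

/-- If two recurrent sequences with coprime characteristic polynomials `minpoly F α` and `f`
cancel on enough consecutive places, then the first one vanishes. -/
theorem eq_zero_of_forall_dual_add_eq_zero {F A B : Type*} [Field F] [Field A] [Field B]
    [Algebra F A] [Algebra F B] [FiniteDimensional F A] {k : ℕ} {α u : A} {β v : B} {f : F[X]}
    (hα : ∀ z : A, z ≠ 0 → ∃ i : ℕ, α ^ i = z) (hfβ : aeval β f = 0) (hfα : aeval α f ≠ 0)
    (hk : (minpoly F α).natDegree + f.natDegree ≤ k)
    {φ : Module.Dual F A} (ψ : Module.Dual F B) (hφ : φ ≠ 0)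
    (h : ∀ i < k, φ (α ^ i * u) + ψ (β ^ i * v) = 0) : u = 0 := by
  have hint : IsIntegral F α := Algebra.IsIntegral.isIntegral α
  have hpoly (p : F[X]) (hp : p.natDegree < k) :
      φ (aeval α p * u) + ψ (aeval β p * v) = 0 := by
    rw [aeval_eq_sum_range' hp, aeval_eq_sum_range' hp, Finset.sum_mul, Finset.sum_mul,
      map_sum, map_sum, ← Finset.sum_add_distrib]
    refine Finset.sum_eq_zero fun i hi => ?_
    rw [smul_mul_assoc, smul_mul_assoc, map_smul, map_smul, ← smul_add,
      h i (Finset.mem_range.mp hi), smul_zero]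
  by_contra hu
  refine hφ (LinearMap.ext fun y => ?_)
  by_cases hy : y = 0
  · simp [hy]
  obtain ⟨i, hi⟩ := hα (y / (aeval α f * u)) (div_ne_zero hy (mul_ne_zero hfα hu))
  have hdeg : (X ^ i %ₘ minpoly F α).natDegree < (minpoly F α).natDegree :=
    natDegree_modByMonic_lt _ (minpoly.monic hint) (minpoly.ne_one F α)
  have hlt : (f * (X ^ i %ₘ minpoly F α)).natDegree < k := by
    have := natDegree_mul_le (p := f) (q := X ^ i %ₘ minpoly F α)
    omega
  have hmod : aeval α (X ^ i %ₘ minpoly F α) = α ^ i := by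
    rw [aeval_modByMonic_eq_self_of_root (minpoly.aeval F α), map_pow, aeval_X]
  have := hpoly _ hlt
  rw [map_mul (aeval α), map_mul (aeval β), hfβ, hmod, hi, zero_mul, zero_mul, map_zero,
    add_zero] at this
  rw [LinearMap.zero_apply, ← this]
  congr 1
  field_simp

/-- A root of the minimal polynomial of `β` has the same order as `β`. -/
theorem orderOf_eq_of_aeval_minpoly_eq_zero {F A B : Type*} [Field F] [Field A] [Field B]
    [Algebra F A] [Algebra F B] [FiniteDimensional F B] {α : A} {β : B}
    (h : aeval α (minpoly F β) = 0) : orderOf α = orderOf β := by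
  have hβ : IsIntegral F β := Algebra.IsIntegral.isIntegral β
  have hmin : minpoly F β = minpoly F α :=
    minpoly.eq_of_irreducible_of_monic (minpoly.irreducible hβ) h (minpoly.monic hβ)
  refine orderOf_eq_orderOf_iff.mpr fun n => ?_
  have hA := minpoly.dvd_iff (A := F) (x := α) (p := X ^ n - 1)
  have hB := minpoly.dvd_iff (A := F) (x := β) (p := X ^ n - 1)
  simp only [map_sub, map_pow, aeval_X, map_one, sub_eq_zero] at hA hB
  rw [← hA, ← hB, hmin]

theorem pow_val_add_natCast {M : Type*} [Monoid M] {n : ℕ} [NeZero n] {α : M}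
    (hα : orderOf α = n) (m : ZMod n) (i : ℕ) :
    α ^ (m + (i : ZMod n)).val = α ^ i * α ^ m.val := by
  rw [ZMod.val_add, ZMod.val_natCast, Nat.add_mod_mod, ← pow_add, add_comm i]
  simpa [hα] using pow_mod_orderOf α (m.val + i)

theorem pow_val_injective {M : Type*} [Monoid M] {n : ℕ} [NeZero n] {α : M}
    (hα : orderOf α = n) : Function.Injective fun m : ZMod n => α ^ m.val := by
  intro m m' h
  refine ZMod.val_injective n (pow_injOn_Iio_orderOf ?_ ?_ h)
  · simpa [hα] using m.val_lt
  · simpa [hα] using m'.val_lt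

theorem exists_pow_eq_galoisField (p a : ℕ) [Fact p.Prime] (ha : a ≠ 0) :
    ∃ α : GaloisField p a, orderOf α = p ^ a - 1 ∧ ∀ z, z ≠ 0 → ∃ i : ℕ, α ^ i = z := by
  obtain ⟨g, hg⟩ := IsCyclic.exists_generator (α := (GaloisField p a)ˣ)
  refine ⟨g, ?_, fun z hz => ?_⟩
  · rw [orderOf_units, orderOf_eq_card_of_forall_mem_zpowers hg, Nat.card_units,
      GaloisField.card p a ha]
  · obtain ⟨i, hi⟩ := mem_powers_iff_mem_zpowers.mpr (hg (Units.mk0 z hz))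
    exact ⟨i, by simpa using congrArg Units.val hi⟩

theorem exists_dual_ne_zero (F A : Type*) [Field F] [Field A] [Algebra F A] :
    ∃ φ : Module.Dual F A, φ ≠ 0 := by
  by_contra! h
  exact one_ne_zero ((Module.forall_dual_apply_eq_zero_iff F (1 : A)).mp fun φ => by simp [h φ])

/-- Maximal-length shift register sequences of distinct orders `a`, `b` with `a + b ≤ k`
have jointly injective windows of length `k`. -/
theorem exists_injective_win_add_win {k a b : ℕ} (p : ℕ) [Fact p.Prime] (ha : a ≠ 0)
    (hb : b ≠ 0) (hab : a ≠ b) (hk : a + b ≤ k) :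
    ∃ (x1 : ZMod (p ^ a - 1) → ZMod p) (x2 : ZMod (p ^ b - 1) → ZMod p), Function.Injective
      (fun m : ZMod (p ^ a - 1) × ZMod (p ^ b - 1) => win k x1 m.1 + win k x2 m.2) := by
  have hp : 1 < p := (Fact.out : p.Prime).one_lt
  have hpa : 1 < p ^ a := Nat.one_lt_pow ha hp
  have hpb : 1 < p ^ b := Nat.one_lt_pow hb hp
  have : NeZero (p ^ a - 1) := ⟨by omega⟩
  have : NeZero (p ^ b - 1) := ⟨by omega⟩
  obtain ⟨α, hα, hαgen⟩ := exists_pow_eq_galoisField p a ha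
  obtain ⟨β, hβ, hβgen⟩ := exists_pow_eq_galoisField p b hb
  obtain ⟨φ, hφ⟩ := exists_dual_ne_zero (ZMod p) (GaloisField p a)
  obtain ⟨ψ, hψ⟩ := exists_dual_ne_zero (ZMod p) (GaloisField p b)
  have hord : orderOf α ≠ orderOf β := by
    rw [hα, hβ]
    intro h
    exact hab (Nat.pow_right_injective hp (by dsimp only; omega))
  have hdeg : (minpoly (ZMod p) α).natDegree + (minpoly (ZMod p) β).natDegree ≤ k := by
    have hdα := minpoly.natDegree_le (A := ZMod p) α
    have hdβ := minpoly.natDegree_le (A := ZMod p) β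
    rw [GaloisField.finrank p ha] at hdα
    rw [GaloisField.finrank p hb] at hdβ
    omega
  refine ⟨fun t => φ (α ^ t.val), fun t => ψ (β ^ t.val), ?_⟩
  rintro ⟨m, n⟩ ⟨m', n'⟩ h
  have hsum (i : ℕ) (hi : i < k) : φ (α ^ i * (α ^ m.val - α ^ m'.val)) +
      ψ (β ^ i * (β ^ n.val - β ^ n'.val)) = 0 := by
    have := congrFun h ⟨i, hi⟩
    simp only [win, Pi.add_apply, pow_val_add_natCast hα, pow_val_add_natCast hβ] at this
    rw [mul_sub, mul_sub, map_sub, map_sub]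
    linear_combination this
  have hu : α ^ m.val - α ^ m'.val = 0 :=
    eq_zero_of_forall_dual_add_eq_zero hαgen (minpoly.aeval (ZMod p) β)
      (fun h0 => hord (orderOf_eq_of_aeval_minpoly_eq_zero h0)) hdeg ψ hφ hsum
  have hv : β ^ n.val - β ^ n'.val = 0 :=
    eq_zero_of_forall_dual_add_eq_zero (k := k) hβgen (minpoly.aeval (ZMod p) α)
      (fun h0 => hord (orderOf_eq_of_aeval_minpoly_eq_zero h0).symm) (by rwa [add_comm]) φ hψ
      fun i hi => by rw [add_comm]; exact hsum i hi
  exact Prod.ext (pow_val_injective hα (sub_eq_zero.mp hu))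
    (pow_val_injective hβ (sub_eq_zero.mp hv))

theorem two_rpow_le_two_pow_sub_one {r : ℝ} {a : ℕ} (hr : 0 ≤ r) (ha : r + 1 ≤ a) :
    (2 : ℝ) ^ r ≤ ((2 ^ a - 1 : ℕ) : ℝ) := by
  have h : (2 : ℝ) ^ (r + 1) ≤ 2 ^ a := by
    rw [← Real.rpow_natCast]
    exact Real.rpow_le_rpow_of_exponent_le one_le_two ha
  have h1 : (1 : ℝ) ≤ 2 ^ r := Real.one_le_rpow one_le_two hr
  rw [Real.rpow_add_one two_ne_zero] at h
  rw [Nat.cast_sub Nat.one_le_two_pow]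
  push_cast
  linarith

theorem stmt13 (R1 R2 : ℝ) (h1 : 0 < R1) (h2 : 0 < R2) (h12 : R1 + R2 < 1) :
    ∃ K : ℕ, ∀ k : ℕ, K ≤ k → ∃ n1 n2 : ℕ,
      (2 : ℝ) ^ (R1 * k) ≤ n1 ∧ (2 : ℝ) ^ (R2 * k) ≤ n2 ∧
      ∃ (x1 : ZMod n1 → ZMod 2) (x2 : ZMod n2 → ZMod 2),
        Function.Injective
          (fun m : ZMod n1 × ZMod n2 => win k x1 m.1 + win k x2 m.2) := by
  refine ⟨⌈5 / (1 - (R1 + R2))⌉₊, fun k hk => ?_⟩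
  have hk5 : 5 ≤ (k : ℝ) * (1 - (R1 + R2)) :=
    (div_le_iff₀ (sub_pos.mpr h12)).mp (Nat.ceil_le.mp hk)
  have hr1 : 0 ≤ R1 * k := by positivity
  have hr2 : 0 ≤ R2 * k := by positivity
  have hl1 := Nat.le_ceil (R1 * k)
  have hl2 := Nat.le_ceil (R2 * k)
  have hu1 := Nat.ceil_lt_add_one hr1
  have hu2 := Nat.ceil_lt_add_one hr2
  obtain ⟨b, hb, hb', hne⟩ : ∃ b, ⌈R2 * k⌉₊ + 1 ≤ b ∧ b ≤ ⌈R2 * k⌉₊ + 2 ∧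
      ⌈R1 * k⌉₊ + 1 ≠ b := by
    by_cases h : ⌈R1 * k⌉₊ + 1 = ⌈R2 * k⌉₊ + 1
    · exact ⟨⌈R2 * k⌉₊ + 2, by omega, by omega, by omega⟩
    · exact ⟨⌈R2 * k⌉₊ + 1, by omega, by omega, h⟩
  have hbl : (⌈R2 * k⌉₊ : ℝ) + 1 ≤ b := by exact_mod_cast hb
  have hbu : (b : ℝ) ≤ ⌈R2 * k⌉₊ + 2 := by exact_mod_cast hb'
  have hsum : ⌈R1 * k⌉₊ + 1 + b ≤ k := by
    have : ((⌈R1 * k⌉₊ + 1 + b : ℕ) : ℝ) ≤ k := by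
      push_cast
      linarith
    exact_mod_cast this
  exact ⟨_, _, two_rpow_le_two_pow_sub_one hr1 (by push_cast; linarith),
    two_rpow_le_two_pow_sub_one hr2 (by linarith),
    exists_injective_win_add_win 2 (by omega) (by omega) hne hsum⟩
end

section
/- Let k, r, n be positive integers with r < k and 2k ≤ n, and let H be a (k−r)×k matrix over GF(2) of full row rank k−r. If 16·k·n ≤ 2^{k−r}, then there exists a binary sequence x ∈ {0,1}^n such that the syndromes H·φ(m), for m ∈ {1,…,n}, of its length-k cyclic windows are pairwise distinct. -/
open Finset

theorem Matrix.mulVec_surjective_of_linearIndependent_rows {F : Type*} [Field F] {q k : ℕ}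
    (H : Matrix (Fin q) (Fin k) F) (hH : LinearIndependent F (fun j => H j)) :
    Function.Surjective H.mulVec := by
  have h1 : H.rank = q := by
    have := LinearIndependent.rank_matrix (M := H) hH
    simpa using this
  have h2 : LinearMap.range H.mulVecLin = ⊤ := by
    apply Submodule.eq_top_of_finrank_eq
    rw [Module.finrank_fin_fun]
    exact h1
  exact LinearMap.range_eq_top.mp h2

theorem natCast_zmod_injOn_lt {n a b : ℕ} (ha : a < n) (hb : b < n)
    (h : (a : ZMod n) = b) : a = b := by
  rw [ZMod.natCast_eq_natCast_iff] at h
  exact Nat.ModEq.eq_of_lt_of_lt h ha hb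

theorem win_add {n k : ℕ} (x y : ZMod n → ZMod 2) (m : ZMod n) :
    win k (x + y) m = win k x m + win k y m := rfl

theorem win_comp_add_left {n k : ℕ} (x : ZMod n → ZMod 2) (s m : ZMod n) :
    win k (fun p => x (s + p)) m = win k x (s + m) := by
  ext i
  simp only [win, add_assoc]

/-- A sequence supported on the window at `m` that has equal windows at `m` and `m'` vanishes
on the window. -/
theorem eq_zero_of_win_eq {n k : ℕ} [NeZero n] (h2k : 2 * k ≤ n) {m m' : ZMod n} (hne : m ≠ m')
    (v : ZMod n → ZMod 2)
    (hv : ∀ j, k ≤ j → j < n → v (m + (j : ZMod n)) = 0)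
    (h : ∀ i : ℕ, i < k → v (m + i) = v (m' + i)) :
    ∀ i : ℕ, i < k → v (m + i) = 0 := by
  obtain ⟨d, hdn, hd⟩ : ∃ d : ℕ, d < n ∧ m' = m + d :=
    ⟨(m' - m).val, ZMod.val_lt _, by simp⟩
  have hd0 : 0 < d := by
    rcases Nat.eq_zero_or_pos d with rfl | h0
    · simp [hd] at hne
    · exact h0
  subst hd
  by_cases hdk : d ≤ n - k
  · have key : ∀ t i : ℕ, i < k → k ≤ i + t → v (m + i) = 0 := by
      intro t
      induction t with
      | zero => intro i hi h'; omega
      | succ t ih =>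
        intro i hi h'
        have e : m + (d : ZMod n) + (i : ZMod n) = m + ((i + d : ℕ) : ZMod n) := by
          push_cast; ring
        rw [h i hi, e]
        by_cases hlt : i + d < k
        · exact ih _ hlt (by omega)
        · exact hv _ (by omega) (by omega)
    intro i hi
    exact key k i hi (by omega)
  · intro i
    induction i using Nat.strong_induction_on with
    | _ i ih =>
      intro hi
      rw [h i hi]
      by_cases hlt : n ≤ i + d
      · have e : m + (d : ZMod n) + (i : ZMod n) = m + ((i + d - n : ℕ) : ZMod n) := by
          rw [Nat.cast_sub hlt]; push_cast; simp; ring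
        rw [e]
        exact ih _ (by omega) (by omega)
      · have e : m + (d : ZMod n) + (i : ZMod n) = m + ((i + d : ℕ) : ZMod n) := by
          push_cast; ring
        rw [e]
        exact hv _ (by omega) (by omega)

/-- The sequence carrying the word `u` on the window at `m` and zero elsewhere. -/
def placeWord {n k : ℕ} (m : ZMod n) : (Fin k → ZMod 2) →ₗ[ZMod 2] (ZMod n → ZMod 2) where
  toFun u p := if h : (p - m).val < k then u ⟨(p - m).val, h⟩ else 0
  map_add' u w := by ext p; by_cases h : (p - m).val < k <;> simp [h]
  map_smul' c u := by ext p; by_cases h : (p - m).val < k <;> simp [h]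

theorem placeWord_add_natCast {n k : ℕ} (m : ZMod n) (u : Fin k → ZMod 2) {j : ℕ} (hj : j < n) :
    placeWord m u (m + j) = if h : j < k then u ⟨j, h⟩ else 0 := by
  have e : (m + (j : ZMod n) - m).val = j := by
    rw [add_sub_cancel_left, ZMod.val_natCast_of_lt hj]
  simp only [placeWord, LinearMap.coe_mk, AddHom.coe_mk, e]

theorem exists_placeWord_win_sub_eq {n k : ℕ} [NeZero n] (h2k : 2 * k ≤ n) {m m' : ZMod n}
    (hne : m ≠ m') (w : Fin k → ZMod 2) :
    ∃ u : Fin k → ZMod 2, win k (placeWord m u) m - win k (placeWord m u) m' = w := by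
  let D : (Fin k → ZMod 2) →ₗ[ZMod 2] (Fin k → ZMod 2) :=
    { toFun u := win k (placeWord m u) m - win k (placeWord m u) m'
      map_add' u w := by rw [map_add, win_add, win_add]; abel
      map_smul' c u := by
        ext i
        simp only [map_smul, win, Pi.sub_apply, Pi.smul_apply, smul_eq_mul, RingHom.id_apply]
        ring }
  have hD : Function.Injective D := by
    rw [injective_iff_map_eq_zero]
    intro u hu
    have hz := eq_zero_of_win_eq h2k hne (placeWord m u)
      (fun j hkj hj => by rw [placeWord_add_natCast m u hj, dif_neg (by omega)])
      (fun i hi => sub_eq_zero.mp (congrFun hu ⟨i, hi⟩))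
    ext i
    have hi := hz i i.2
    rwa [placeWord_add_natCast m u (by omega), dif_pos i.2] at hi
  exact LinearMap.injective_iff_surjective.mp hD w

open Classical in
/-- Sequences in which the windows contained in the arc of length `L` starting at `s` have
pairwise distinct syndromes. -/
noncomputable def arcDistinct {n k q : ℕ} [NeZero n] (H : Matrix (Fin q) (Fin k) (ZMod 2))
    (s : ZMod n) (L : ℕ) : Finset (ZMod n → ZMod 2) :=
  {x | ∀ i j : ℕ, i < j → j + k ≤ L →
    H.mulVec (win k x (s + i)) ≠ H.mulVec (win k x (s + j))}

section
variable {n k q : ℕ} [NeZero n] {H : Matrix (Fin q) (Fin k) (ZMod 2)}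

theorem arcDistinct_subset {s : ZMod n} {t L L' : ℕ} (h : t + L' ≤ L) :
    arcDistinct H s L ⊆ arcDistinct H (s + t) L' := by
  intro x hx
  simp only [arcDistinct, mem_filter, mem_univ, true_and] at hx ⊢
  intro i j hij hj
  simpa [add_assoc] using hx (t + i) (t + j) (by omega) (by omega)

theorem card_arcDistinct (s : ZMod n) (L : ℕ) :
    #(arcDistinct H s L) = #(arcDistinct H (0 : ZMod n) L) := by
  refine card_bij' (fun x _ => fun p => x (s + p)) (fun x _ => fun p => x (p - s)) ?_ ?_ ?_ ?_
  · intro x hx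
    simp only [arcDistinct, mem_filter, mem_univ, true_and] at hx ⊢
    intro i j hij hj
    simpa [win_comp_add_left] using hx i j hij hj
  · intro x hx
    simp only [arcDistinct, mem_filter, mem_univ, true_and] at hx ⊢
    intro i j hij hj
    simpa [sub_eq_neg_add, win_comp_add_left (n := n)] using hx i j hij hj
  · intro x _; ext p; simp
  · intro x _; ext p; simp

theorem add_placeWord_mem_arcDistinct {s : ZMod n} {L : ℕ} (hL : L + k ≤ n)
    {x : ZMod n → ZMod 2} (hx : x ∈ arcDistinct H s L) (u : Fin k → ZMod 2) :
    x + placeWord (s + (L : ZMod n)) u ∈ arcDistinct H s L := by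
  have hz : ∀ i : ℕ, i < L → placeWord (s + (L : ZMod n)) u (s + i) = 0 := by
    intro i hi
    have e : s + (i : ZMod n) = s + L + ((n - L + i : ℕ) : ZMod n) := by
      rw [Nat.cast_add, Nat.cast_sub (by omega)]; simp
    rw [e, placeWord_add_natCast _ _ (by omega), dif_neg (by omega)]
  have hw : ∀ i : ℕ, i + k ≤ L →
      win k (x + placeWord (s + (L : ZMod n)) u) (s + i) = win k x (s + i) := by
    intro i hi
    ext j
    have := hz (i + j) (by omega)
    simp only [Nat.cast_add, ← add_assoc] at this
    simp [win, this]
  simp only [arcDistinct, mem_filter, mem_univ, true_and] at hx ⊢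
  intro i j hij hj
  rw [hw i (by omega), hw j hj]
  exact hx i j hij hj

theorem card_arcDistinct_collision_mul_le (h2k : 2 * k ≤ n) (hH : Function.Surjective H.mulVec)
    (s : ZMod n) {L : ℕ} (hL : L + k ≤ n) {m' : ZMod n} (hne : s + (L : ZMod n) ≠ m') :
    #{x ∈ arcDistinct H s L | H.mulVec (win k x (s + (L : ZMod n))) = H.mulVec (win k x m')} * 2 ^ q
      ≤ #(arcDistinct H s L) := by
  have hsec : ∀ c : Fin q → ZMod 2, ∃ u : Fin k → ZMod 2,
      H.mulVec (win k (placeWord (s + (L : ZMod n)) u) (s + (L : ZMod n))) -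
        H.mulVec (win k (placeWord (s + (L : ZMod n)) u) m') = c := by
    intro c
    obtain ⟨w, rfl⟩ := hH c
    obtain ⟨u, rfl⟩ := exists_placeWord_win_sub_eq h2k hne w
    exact ⟨u, (Matrix.mulVec_sub _ _ _).symm⟩
  choose f hf using hsec
  have hq : 2 ^ q = #(univ : Finset (Fin q → ZMod 2)) := by simp [ZMod.card]
  rw [hq, ← card_product]
  refine card_le_card_of_injOn (fun p => p.1 + placeWord (s + (L : ZMod n)) (f p.2)) ?_ ?_
  · rintro ⟨x, c⟩ hp
    simp only [coe_product, Set.mem_prod, mem_coe, mem_filter] at hp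
    exact add_placeWord_mem_arcDistinct hL hp.1.1 _
  · have hrec : ∀ x c, H.mulVec (win k x (s + (L : ZMod n))) = H.mulVec (win k x m') →
        H.mulVec (win k (x + placeWord (s + (L : ZMod n)) (f c)) (s + (L : ZMod n))) -
          H.mulVec (win k (x + placeWord (s + (L : ZMod n)) (f c)) m') = c := by
      intro x c hx
      rw [win_add, win_add, Matrix.mulVec_add, Matrix.mulVec_add, hx, add_sub_add_left_eq_sub, hf]
    rintro ⟨x, c⟩ hp ⟨y, e⟩ hp' heq
    simp only [coe_product, Set.mem_prod, mem_coe, mem_filter] at hp hp' heq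
    have hce : c = e := by rw [← hrec x c hp.1.2, ← hrec y e hp'.1.2, heq]
    subst hce
    simpa using heq

theorem arcDistinct_sdiff_subset (hk : 0 < k) (s : ZMod n) (b : ℕ) :
    arcDistinct H s (b + k - 1) \ arcDistinct H s (b + k) ⊆
      (range b).biUnion fun i =>
        {x ∈ arcDistinct H s b |
          H.mulVec (win k x (s + (b : ZMod n))) = H.mulVec (win k x (s + (i : ZMod n)))} := by
  intro x hx
  rw [mem_sdiff] at hx
  obtain ⟨hx, hnot⟩ := hx
  simp only [mem_biUnion, mem_range, mem_filter]
  have hxb : b ≤ b + k - 1 → x ∈ arcDistinct H s b := by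
    intro hb
    simpa using arcDistinct_subset (t := 0) (by omega : 0 + b ≤ b + k - 1) hx
  simp only [arcDistinct, mem_filter, mem_univ, true_and] at hx hnot
  push Not at hnot
  obtain ⟨i, j, hij, hj, heq⟩ := hnot
  have hjb : j = b := by
    by_contra hne
    exact hx i j hij (by omega) heq
  subst hjb
  exact ⟨i, hij, hxb (by omega), heq.symm⟩

theorem le_two_mul_of_geometric {a : ℕ → ℝ} {k b j : ℕ} (hjk : j ≤ k) (hb : 0 ≤ a b)
    (h : ∀ i < j, (1 - 1 / (2 * k : ℝ)) * a (b + i) ≤ a (b + i + 1)) :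
    a b ≤ 2 * a (b + j) := by
  rcases Nat.eq_zero_or_pos k with rfl | hk
  · obtain rfl : j = 0 := by omega
    simp only [add_zero]; linarith
  have hk' : (1 : ℝ) ≤ k := by exact_mod_cast hk
  have hε : 1 / (2 * k : ℝ) ≤ 1 / 2 := one_div_le_one_div_of_le (by norm_num) (by linarith)
  have hpow : ∀ i ≤ j, (1 - 1 / (2 * k : ℝ)) ^ i * a b ≤ a (b + i) := by
    intro i
    induction i with
    | zero => simp
    | succ i ih =>
      intro hi
      refine le_trans ?_ (h i (by omega))
      rw [pow_succ', mul_assoc]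
      exact mul_le_mul_of_nonneg_left (ih (by omega)) (by linarith)
  have hbern := one_add_mul_le_pow (a := -(1 / (2 * k : ℝ))) (by linarith) j
  rw [← sub_eq_add_neg] at hbern
  have hj : (j : ℝ) * (1 / (2 * k : ℝ)) ≤ 1 / 2 := by
    rw [mul_one_div, div_le_div_iff₀ (by linarith) (by norm_num)]
    have : (j : ℝ) ≤ k := by exact_mod_cast hjk
    linarith
  have hhalf : 1 / 2 * a b ≤ (1 - 1 / (2 * k : ℝ)) ^ j * a b :=
    mul_le_mul_of_nonneg_right (by linarith) hb
  linarith [hpow j le_rfl]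

theorem card_arcDistinct_succ_ge (hk : 0 < k) (h2k : 2 * k ≤ n)
    (hH : Function.Surjective H.mulVec) (hcount : 16 * k * n ≤ 2 ^ q) (L : ℕ) (hL : L < n) :
    (1 - 1 / (2 * k : ℝ)) * #(arcDistinct H (0 : ZMod n) L) ≤
      #(arcDistinct H (0 : ZMod n) (L + 1)) := by
  induction L using Nat.strong_induction_on with
  | _ L ih =>
  have hk' : (0 : ℝ) < k := by exact_mod_cast hk
  by_cases hLk : L + 1 < k
  · have hsub : arcDistinct H (0 : ZMod n) L ⊆ arcDistinct H (0 : ZMod n) (L + 1) := by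
      intro x _
      simp only [arcDistinct, mem_filter, mem_univ, true_and]
      intro i j _ hj
      omega
    have h1 : (#(arcDistinct H (0 : ZMod n) L) : ℝ) ≤ #(arcDistinct H (0 : ZMod n) (L + 1)) := by
      exact_mod_cast card_le_card hsub
    refine le_trans (mul_le_of_le_one_left (by positivity) ?_) h1
    have : 0 < 1 / (2 * k : ℝ) := by positivity
    linarith
  obtain ⟨b, hb⟩ : ∃ b, L + 1 = b + k := ⟨L + 1 - k, by omega⟩
  have hLb : L = b + k - 1 := by omega
  have hab : (#(arcDistinct H (0 : ZMod n) b) : ℝ) ≤ 2 * #(arcDistinct H (0 : ZMod n) L) := by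
    have := le_two_mul_of_geometric (a := fun i => (#(arcDistinct H (0 : ZMod n) i) : ℝ))
      (k := k) (b := b) (j := k - 1) (by omega) (by positivity)
      (fun i hi => ih (b + i) (by omega) (by omega))
    rwa [show b + (k - 1) = L by omega] at this
  have hbad : #(arcDistinct H (0 : ZMod n) L \ arcDistinct H (0 : ZMod n) (L + 1)) * 2 ^ q
      ≤ b * #(arcDistinct H (0 : ZMod n) b) := by
    rw [hb, hLb]
    refine le_trans (Nat.mul_le_mul_right _ ((card_le_card
      (arcDistinct_sdiff_subset hk 0 b)).trans card_biUnion_le)) ?_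
    rw [sum_mul]
    refine (sum_le_card_nsmul _ _ #(arcDistinct H (0 : ZMod n) b) ?_).trans (by simp)
    intro i hi
    rw [mem_range] at hi
    refine card_arcDistinct_collision_mul_le h2k hH 0 (by omega) ?_
    intro he
    have := natCast_zmod_injOn_lt (by omega) (by omega) (add_left_cancel he)
    omega
  have hsplit := card_le_card_sdiff_add_card (s := arcDistinct H (0 : ZMod n) L)
    (t := arcDistinct H (0 : ZMod n) (L + 1))
  set d := #(arcDistinct H (0 : ZMod n) L \ arcDistinct H (0 : ZMod n) (L + 1))
  set aL := #(arcDistinct H (0 : ZMod n) L)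
  set ab := #(arcDistinct H (0 : ZMod n) b)
  have hab' : ab ≤ 2 * aL := by exact_mod_cast hab
  have hd : d * (16 * k) ≤ 2 * aL := by
    refine Nat.le_of_mul_le_mul_right ?_ (show 0 < n by omega)
    calc d * (16 * k) * n = d * (16 * k * n) := by ring
      _ ≤ d * 2 ^ q := Nat.mul_le_mul_left _ hcount
      _ ≤ b * ab := hbad
      _ ≤ n * (2 * aL) := Nat.mul_le_mul (by omega) hab'
      _ = 2 * aL * n := by ring
  have hd' : (d : ℝ) ≤ 1 / (2 * k : ℝ) * aL := by
    rw [one_div_mul_eq_div, le_div_iff₀ (by positivity)]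
    have : (d : ℝ) * (16 * k) ≤ 2 * aL := by exact_mod_cast hd
    have h0 : (0 : ℝ) ≤ aL := by positivity
    linarith
  have hsplit' : (aL : ℝ) ≤ d + #(arcDistinct H (0 : ZMod n) (L + 1)) := by exact_mod_cast hsplit
  linarith

theorem card_arcDistinct_pos (hk : 0 < k) (h2k : 2 * k ≤ n)
    (hH : Function.Surjective H.mulVec) (hcount : 16 * k * n ≤ 2 ^ q) (L : ℕ) (hL : L ≤ n) :
    0 < #(arcDistinct H (0 : ZMod n) L) := by
  induction L with
  | zero =>
    refine card_pos.mpr ⟨0, ?_⟩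
    simp only [arcDistinct, mem_filter, mem_univ, true_and]
    intro i j _ _
    omega
  | succ L ih =>
    have h1 : (0 : ℝ) < #(arcDistinct H (0 : ZMod n) L) := by exact_mod_cast ih (by omega)
    have hk' : (1 : ℝ) ≤ k := by exact_mod_cast hk
    have hε : 1 / (2 * k : ℝ) ≤ 1 / 2 := one_div_le_one_div_of_le (by norm_num) (by linarith)
    have h2 := card_arcDistinct_succ_ge hk h2k hH hcount L (by omega)
    have h3 : (0 : ℝ) < #(arcDistinct H (0 : ZMod n) (L + 1)) :=
      lt_of_lt_of_le (mul_pos (by linarith) h1) h2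
    exact_mod_cast h3

/-- Two equal syndromes on a sequence with distinct syndromes on its non-wrapping windows must
involve a wrapping window `-i`, `i < k`. -/
theorem exists_wrapping_collision {x : ZMod n → ZMod 2}
    (hx : x ∈ arcDistinct H (0 : ZMod n) n)
    (hinj : ¬ Function.Injective (fun m : ZMod n => H.mulVec (win k x m))) :
    ∃ i < k, ∃ m' : ZMod n, -(i : ZMod n) ≠ m' ∧
      H.mulVec (win k x (-(i : ZMod n))) = H.mulVec (win k x m') := by
  simp only [Function.Injective] at hinj
  push Not at hinj
  obtain ⟨m, m', heq, hne⟩ := hinj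
  wlog hlt : m.val < m'.val generalizing m m'
  · refine this m' m heq.symm hne.symm (lt_of_le_of_ne (not_lt.mp hlt) ?_)
    exact fun h => hne (ZMod.val_injective n h).symm
  have hm' := ZMod.val_lt m'
  refine ⟨n - m'.val, ?_, m, ?_⟩
  · by_contra hge
    simp only [arcDistinct, mem_filter, mem_univ, true_and] at hx
    refine hx m.val m'.val hlt (by omega) ?_
    simpa using heq
  · have e : -((n - m'.val : ℕ) : ZMod n) = m' := by
      rw [Nat.cast_sub hm'.le]; simp
    rw [e]
    exact ⟨hne.symm, heq.symm⟩

theorem exists_injective_syndrome (hk : 0 < k) (h2k : 2 * k ≤ n)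
    (hH : Function.Surjective H.mulVec) (hcount : 16 * k * n ≤ 2 ^ q) :
    ∃ x : ZMod n → ZMod 2, Function.Injective (fun m : ZMod n => H.mulVec (win k x m)) := by
  by_contra! hall
  set a' := #(arcDistinct H (0 : ZMod n) (n - k)) with ha'
  have hcast : ∀ i : ℕ, i < k →
      ((k - i : ℕ) : ZMod n) + ((n - k : ℕ) : ZMod n) = -(i : ZMod n) := by
    intro i hi
    rw [Nat.cast_sub hi.le, Nat.cast_sub (by omega)]; simp; ring
  have hsub : arcDistinct H (0 : ZMod n) n ⊆
      (range k).biUnion fun i => ({m' | -(i : ZMod n) ≠ m'} : Finset (ZMod n)).biUnion fun m' =>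
        {x ∈ arcDistinct H ((k - i : ℕ) : ZMod n) (n - k) |
          H.mulVec (win k x (((k - i : ℕ) : ZMod n) + ((n - k : ℕ) : ZMod n)))
            = H.mulVec (win k x m')} := by
    intro x hx
    obtain ⟨i, hi, m', hne, heq⟩ := exists_wrapping_collision hx (hall x)
    simp only [mem_biUnion, mem_range, mem_filter, mem_univ, true_and]
    refine ⟨i, hi, m', hne, ?_, by rw [hcast i hi]; exact heq⟩
    simpa using arcDistinct_subset (t := k - i) (L' := n - k) (by omega) hx
  have hbad : #(arcDistinct H (0 : ZMod n) n) * 2 ^ q ≤ k * (n * a') := by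
    refine (Nat.mul_le_mul_right _ ((card_le_card hsub).trans card_biUnion_le)).trans ?_
    rw [sum_mul]
    refine (sum_le_card_nsmul _ _ (n * a') ?_).trans (by simp)
    intro i hi
    rw [mem_range] at hi
    refine (Nat.mul_le_mul_right _ card_biUnion_le).trans ?_
    rw [sum_mul]
    refine (sum_le_card_nsmul _ _ a' ?_).trans ?_
    · intro m' hm'
      rw [mem_filter] at hm'
      rw [ha', ← card_arcDistinct ((k - i : ℕ) : ZMod n)]
      refine card_arcDistinct_collision_mul_le h2k hH _ (by omega) ?_
      rw [hcast i hi]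
      exact hm'.2
    · rw [smul_eq_mul]
      exact Nat.mul_le_mul_right _ ((card_le_univ _).trans (by rw [ZMod.card]))
  have hgrow : a' ≤ 2 * #(arcDistinct H (0 : ZMod n) n) := by
    have := le_two_mul_of_geometric (a := fun i => (#(arcDistinct H (0 : ZMod n) i) : ℝ))
      (k := k) (b := n - k) (j := k) le_rfl (by positivity)
      (fun i hi => card_arcDistinct_succ_ge hk h2k hH hcount _ (by omega))
    rw [Nat.sub_add_cancel (by omega)] at this
    exact_mod_cast this
  have hpos := card_arcDistinct_pos hk h2k hH hcount n le_rfl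
  set a := #(arcDistinct H (0 : ZMod n) n)
  have hkn : 0 < k * n := Nat.mul_pos hk (by omega)
  have h1 : a * 16 * (k * n) ≤ 2 * a * (k * n) :=
    calc a * 16 * (k * n) = a * (16 * k * n) := by ring
      _ ≤ a * 2 ^ q := Nat.mul_le_mul_left _ hcount
      _ ≤ k * (n * a') := hbad
      _ = a' * (k * n) := by ring
      _ ≤ 2 * a * (k * n) := Nat.mul_le_mul_right _ hgrow
  have := Nat.le_of_mul_le_mul_right h1 hkn
  omega

end

theorem stmt14 (k r n : ℕ) (hk : 0 < k) (hr : 0 < r) (hrk : r < k) (hn : 0 < n)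
    (h2k : 2 * k ≤ n)
    (H : Matrix (Fin (k - r)) (Fin k) (ZMod 2))
    (hrank : LinearIndependent (ZMod 2) (fun j : Fin (k - r) => H j))
    (hcount : 16 * k * n ≤ 2 ^ (k - r)) :
    ∃ x : ZMod n → ZMod 2,
      Function.Injective (fun m : ZMod n => H.mulVec (win k x m)) := by
  have : NeZero n := ⟨hn.ne'⟩
  exact exists_injective_syndrome hk h2k
    (H.mulVec_surjective_of_linearIndependent_rows hrank) hcount
end

section
/- Let k > r ≥ 1, let x₁ ∈ {0,1}^{n₁} and x₂ ∈ {0,1}^{n₂} be binary sequences with length-k cyclic windows φ₁(m₁) and φ₂(m₂), and let H be a (k−r)×k matrix over GF(2). Suppose that (i) the windows φ₁(1),…,φ₁(n₁) are pairwise distinct and satisfy H·φ₁(m₁) = 0 for every m₁ ∈ {1,…,n₁}, and (ii) the syndromes H·φ₂(m₂), m₂ ∈ {1,…,n₂}, are pairwise distinct. Then the map (m₁,m₂) ↦ φ₁(m₁) ⊕ φ₂(m₂) (coordinatewise sum modulo 2) is injective on {1,…,n₁} × {1,…,n₂}. -/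
theorem stmt15 (k r n1 n2 : ℕ) (hr : 1 ≤ r) (hrk : r < k)
    (x1 : ZMod n1 → ZMod 2) (x2 : ZMod n2 → ZMod 2)
    (H : Matrix (Fin (k - r)) (Fin k) (ZMod 2))
    (h1inj : Function.Injective (fun m : ZMod n1 => win k x1 m))
    (h1ker : ∀ m : ZMod n1, H.mulVec (win k x1 m) = 0)
    (h2inj : Function.Injective (fun m : ZMod n2 => H.mulVec (win k x2 m))) :
    Function.Injective
      (fun m : ZMod n1 × ZMod n2 => win k x1 m.1 + win k x2 m.2) := by
  rintro ⟨a, b⟩ ⟨c, d⟩ h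
  have hbd : b = d := h2inj <| by
    simpa [Matrix.mulVec_add, h1ker] using congrArg H.mulVec h
  subst hbd
  have hac : a = c := h1inj (add_right_cancel h)
  rw [hac]
end

section
/- Let a₁(z) and a₂(z) be distinct primitive polynomials over GF(2) of degrees r₁ ≥ 1 and r₂ ≥ 1, and set n₁ = 2^{r₁} − 1, n₂ = 2^{r₂} − 1. Let x₁ ∈ {0,1}^{n₁} and x₂ ∈ {0,1}^{n₂} be nonzero sequences satisfying the cyclic LFSR recursions with characteristic polynomials a₁(z) and a₂(z) respectively (i.e., writing a_s(z) = z^{r_s} + Σ_{i=0}^{r_s−1} a_{s,i} z^i, the sequence x_s satisfies x_{s, r_s + j} = Σ_{i=0}^{r_s−1} a_{s,i} x_{s, i+j} (mod 2) for all j ∈ {1,…,n_s}, indices cyclic modulo n_s, s = 1,2). Then for every window length k with r₁ + r₂ ≤ k ≤ min(n₁, n₂), the map (m₁,m₂) ↦ φ₁(m₁) ⊕ φ₂(m₂) (coordinatewise sum modulo 2 of the length-k cyclic windows) is injective on {1,…,n₁} × {1,…,n₂}. -/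
/-- The monic polynomial `z^r + ∑_{i=0}^{r-1} a_i z^i` over GF(2). -/
noncomputable def lfsrPoly {r : ℕ} (a : Fin r → ZMod 2) : Polynomial (ZMod 2) :=
  Polynomial.X ^ r + ∑ i : Fin r, Polynomial.C (a i) * Polynomial.X ^ (i : ℕ)

/-- `a(z) = z^r + ∑_{i=0}^{r-1} a_i z^i` is primitive over GF(2): it is irreducible and
the residue class of `z` in `GF(2)[z]/(a(z))` has multiplicative order `2^r - 1`. -/
def IsPrimitivePoly {r : ℕ} (a : Fin r → ZMod 2) : Prop :=
  Irreducible (lfsrPoly a) ∧ orderOf (AdjoinRoot.root (lfsrPoly a)) = 2 ^ r - 1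

/-- The cyclic LFSR recursion `x_{r+j} = ∑_{i=0}^{r-1} a_i x_{i+j}` (mod 2),
for all `j`, indices cyclic modulo `n`. -/
def IsLFSR {n r : ℕ} (a : Fin r → ZMod 2) (x : ZMod n → ZMod 2) : Prop :=
  ∀ j : ZMod n, x (j + (r : ZMod n)) = ∑ i : Fin r, a i * x (j + ((i : ℕ) : ZMod n))


/-- The left shift `w ↦ (t ↦ w (t + 1))` on sequences over GF(2), as a linear endomorphism. -/
noncomputable def seqShift : Module.End (ZMod 2) (ℕ → ZMod 2) :=
  LinearMap.funLeft (ZMod 2) (ZMod 2) Nat.succ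

theorem seqShift_pow_apply (i : ℕ) (w : ℕ → ZMod 2) (t : ℕ) :
    (seqShift ^ i) w t = w (t + i) := by
  induction i generalizing t with
  | zero => rfl
  | succ i ih =>
    rw [pow_succ', Module.End.mul_apply]
    change ((seqShift ^ i) w) (t + 1) = _
    rw [ih, add_assoc, add_comm 1 i]

theorem aeval_seqShift_apply (p : Polynomial (ZMod 2)) (w : ℕ → ZMod 2) (t : ℕ) :
    Polynomial.aeval seqShift p w t = ∑ i ∈ Finset.range (p.natDegree + 1),
      p.coeff i * w (t + i) := by
  simp [Polynomial.aeval_eq_sum_range, LinearMap.sum_apply, Finset.sum_apply,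
    seqShift_pow_apply]

theorem eq_zero_of_aeval_seqShift_eq_zero {p : Polynomial (ZMod 2)} (hp : p.Monic)
    {w : ℕ → ZMod 2} (h : Polynomial.aeval seqShift p w = 0)
    (h0 : ∀ t < p.natDegree, w t = 0) : w = 0 := by
  funext t
  induction t using Nat.strong_induction_on with
  | _ t ih =>
    rcases lt_or_ge t p.natDegree with ht | ht
    · exact h0 t ht
    · have key := congrFun h (t - p.natDegree)
      rw [aeval_seqShift_apply, Finset.sum_range_succ, Finset.sum_eq_zero, hp.coeff_natDegree,
        Nat.sub_add_cancel ht] at key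
      · simpa using key
      · intro i hi
        rw [Finset.mem_range] at hi
        rw [ih _ (by omega)]
        simp

theorem eq_zero_of_isCoprime_aeval_seqShift {p q : Polynomial (ZMod 2)} (hpq : IsCoprime p q)
    {w : ℕ → ZMod 2} (hp : Polynomial.aeval seqShift p w = 0)
    (hq : Polynomial.aeval seqShift q w = 0) : w = 0 := by
  obtain ⟨u, v, huv⟩ := hpq
  have h := congrArg (fun f => Polynomial.aeval seqShift f w) huv
  simpa [Module.End.mul_apply, hp, hq] using h.symm

theorem degree_lfsrPoly_tail_lt {r : ℕ} (a : Fin r → ZMod 2) :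
    (∑ i : Fin r, Polynomial.C (a i) * Polynomial.X ^ (i : ℕ)).degree < (r : WithBot ℕ) :=
  Polynomial.degree_sum_fin_lt a

theorem lfsrPoly_monic {r : ℕ} (a : Fin r → ZMod 2) : (lfsrPoly a).Monic :=
  Polynomial.monic_X_pow_add (degree_lfsrPoly_tail_lt a)

theorem natDegree_lfsrPoly {r : ℕ} (a : Fin r → ZMod 2) : (lfsrPoly a).natDegree = r := by
  apply Polynomial.natDegree_eq_of_degree_eq_some
  rw [lfsrPoly, Polynomial.degree_add_eq_left_of_degree_lt]
  · simp
  · simpa using degree_lfsrPoly_tail_lt a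

/-- The one-sided infinite sequence read off the cyclic sequence `x` from phase `m` on. -/
def phaseSeq {n : ℕ} (x : ZMod n → ZMod 2) (m : ZMod n) : ℕ → ZMod 2 :=
  fun t => x (m + (t : ZMod n))

theorem aeval_lfsrPoly_phaseSeq {n r : ℕ} {a : Fin r → ZMod 2} {x : ZMod n → ZMod 2}
    (hx : IsLFSR a x) (m : ZMod n) :
    Polynomial.aeval seqShift (lfsrPoly a) (phaseSeq x m) = 0 := by
  funext t
  have h := hx (m + t)
  simp only [add_assoc] at h
  simp [lfsrPoly, LinearMap.sum_apply, Finset.sum_apply, Module.End.mul_apply,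
    Module.algebraMap_end_apply, seqShift_pow_apply, phaseSeq, h, CharTwo.add_self_eq_zero]

theorem phaseSeq_injective {n r : ℕ} [NeZero n] {a : Fin r → ZMod 2} {x : ZMod n → ZMod 2}
    (hirr : Irreducible (lfsrPoly a)) (hord : orderOf (AdjoinRoot.root (lfsrPoly a)) = n)
    (hx0 : x ≠ 0) (hx : IsLFSR a x) : Function.Injective (phaseSeq x) := by
  have hpow (m : ZMod n) : phaseSeq x m = (seqShift ^ m.val) (phaseSeq x 0) := by
    funext t
    simp [seqShift_pow_apply, phaseSeq, add_comm]
  intro m m' hmm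
  have hq : Polynomial.aeval seqShift
      (Polynomial.X ^ m.val - Polynomial.X ^ m'.val : Polynomial (ZMod 2))
      (phaseSeq x 0) = 0 := by
    simp [← hpow, hmm]
  by_cases hd : lfsrPoly a ∣ Polynomial.X ^ m.val - Polynomial.X ^ m'.val
  · have hroot : AdjoinRoot.root (lfsrPoly a) ^ m.val = AdjoinRoot.root (lfsrPoly a) ^ m'.val := by
      simpa [sub_eq_zero] using AdjoinRoot.mk_eq_zero.mpr hd
    apply ZMod.val_injective n
    exact pow_injOn_Iio_orderOf (by simpa [hord] using m.val_lt)
      (by simpa [hord] using m'.val_lt) hroot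
  · have hz := eq_zero_of_isCoprime_aeval_seqShift (hirr.coprime_iff_not_dvd.mpr hd)
      (aeval_lfsrPoly_phaseSeq hx 0) hq
    refine absurd ?_ hx0
    funext j
    simpa [phaseSeq] using congrFun hz j.val

theorem stmt16 (r1 r2 : ℕ) (hr1 : 1 ≤ r1) (hr2 : 1 ≤ r2)
    (a1 : Fin r1 → ZMod 2) (a2 : Fin r2 → ZMod 2)
    (hprim1 : IsPrimitivePoly a1) (hprim2 : IsPrimitivePoly a2)
    (hne : lfsrPoly a1 ≠ lfsrPoly a2)
    (x1 : ZMod (2 ^ r1 - 1) → ZMod 2) (x2 : ZMod (2 ^ r2 - 1) → ZMod 2)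
    (hx1 : x1 ≠ 0) (hx2 : x2 ≠ 0)
    (hrec1 : IsLFSR a1 x1) (hrec2 : IsLFSR a2 x2)
    (k : ℕ) (hk1 : r1 + r2 ≤ k) (hk2 : k ≤ min (2 ^ r1 - 1) (2 ^ r2 - 1)) :
    Function.Injective
      (fun m : ZMod (2 ^ r1 - 1) × ZMod (2 ^ r2 - 1) =>
        win k x1 m.1 + win k x2 m.2) := by
  have : NeZero (2 ^ r1 - 1) := ⟨by omega⟩
  have : NeZero (2 ^ r2 - 1) := ⟨by omega⟩
  rintro ⟨m1, m2⟩ ⟨l1, l2⟩ h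
  set d1 := phaseSeq x1 m1 - phaseSeq x1 l1 with hd1
  set d2 := phaseSeq x2 l2 - phaseSeq x2 m2 with hd2
  have hk1' : Polynomial.aeval seqShift (lfsrPoly a1) d1 = 0 := by
    rw [hd1, map_sub, aeval_lfsrPoly_phaseSeq hrec1, aeval_lfsrPoly_phaseSeq hrec1, sub_zero]
  have hk2' : Polynomial.aeval seqShift (lfsrPoly a2) d2 = 0 := by
    rw [hd2, map_sub, aeval_lfsrPoly_phaseSeq hrec2, aeval_lfsrPoly_phaseSeq hrec2, sub_zero]
  have hw : d1 - d2 = 0 := by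
    refine eq_zero_of_aeval_seqShift_eq_zero ((lfsrPoly_monic a1).mul (lfsrPoly_monic a2)) ?_ ?_
    · have e1 : Polynomial.aeval seqShift (lfsrPoly a1 * lfsrPoly a2) d1 = 0 := by
        rw [mul_comm, map_mul, Module.End.mul_apply, hk1', map_zero]
      have e2 : Polynomial.aeval seqShift (lfsrPoly a1 * lfsrPoly a2) d2 = 0 := by
        rw [map_mul, Module.End.mul_apply, hk2', map_zero]
      rw [map_sub, e1, e2, sub_zero]
    · intro t ht
      rw [(lfsrPoly_monic a1).natDegree_mul (lfsrPoly_monic a2), natDegree_lfsrPoly,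
        natDegree_lfsrPoly] at ht
      have ht' : x1 (m1 + t) + x2 (m2 + t) = x1 (l1 + t) + x2 (l2 + t) :=
        congrFun h ⟨t, by omega⟩
      change x1 (m1 + t) - x1 (l1 + t) - (x2 (l2 + t) - x2 (m2 + t)) = 0
      linear_combination ht'
  have hcop : IsCoprime (lfsrPoly a1) (lfsrPoly a2) :=
    hprim1.1.coprime_iff_not_dvd.mpr fun hdvd => hne <|
      Polynomial.eq_of_monic_of_associated (lfsrPoly_monic a1) (lfsrPoly_monic a2)
        (hprim1.1.associated_of_dvd hprim2.1 hdvd)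
  have hd12 : d1 = d2 := sub_eq_zero.mp hw
  have hz1 : d1 = 0 := eq_zero_of_isCoprime_aeval_seqShift hcop hk1' (hd12 ▸ hk2')
  have hz2 : d2 = 0 := hd12 ▸ hz1
  rw [Prod.mk.injEq]
  exact ⟨phaseSeq_injective hprim1.1 hprim1.2 hx1 hrec1 (sub_eq_zero.mp hz1),
    (phaseSeq_injective hprim2.1 hprim2.2 hx2 hrec2 (sub_eq_zero.mp hz2)).symm⟩
end
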